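/- arXiv:1909.10905 — 2 statements merged into one kernel-verified Lean document; each statement's English description precedes it below -/
import Mathlib

section
/- Let n ≥ 2 and let k be a nonzero integer. Any two distinct elements u, v of X have a least upper bound u ∨_r v in the poset ([1,λ^k]_r, ⪯_r), and this right least common multiple coincides with the least upper bound u ∨ v of u and v in the poset ([1,λ^k], ⪯). -/
/-- The indeterminate `x` in the field `K = ℚ(x)` of rational functions over `ℚ`. -/
noncomputable def xx : RatFunc ℚ := RatFunc.X

/-- Membership in `G(∞,∞,n)`: a monomial matrix whose nonzero entries are integer powers
of `x` and such that the product of the nonzero entries is `1`. -/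
def IsGinf (n : ℕ) (w : Matrix (Fin n) (Fin n) (RatFunc ℚ)) : Prop :=
  (∀ i : Fin n, ∃! c : Fin n, w i c ≠ 0) ∧
  (∀ c : Fin n, ∃! i : Fin n, w i c ≠ 0) ∧
  (∀ i c : Fin n, w i c ≠ 0 → ∃ k : ℤ, w i c = xx ^ k) ∧
  (∏ i : Fin n, ∑ c : Fin n, w i c) = 1

/-- The generator `t_i` (1-indexed rows/columns 1,2 are `Fin` indices 0,1). -/
noncomputable def tMat (n : ℕ) (i : ℤ) : Matrix (Fin n) (Fin n) (RatFunc ℚ) :=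
  fun r c =>
    if r.val = 0 ∧ c.val = 1 then xx ^ (-i)
    else if r.val = 1 ∧ c.val = 0 then xx ^ i
    else if r = c ∧ 2 ≤ r.val then 1 else 0

/-- The generator `s_j` (`3 ≤ j ≤ n`): permutation matrix of the transposition exchanging
coordinates `j-1` and `j` (1-indexed), i.e. `Fin` indices `j-2` and `j-1`. -/
noncomputable def sMat (n : ℕ) (j : ℕ) : Matrix (Fin n) (Fin n) (RatFunc ℚ) :=
  fun r c =>
    if (r.val + 2 = j ∧ c.val + 1 = j) ∨ (r.val + 1 = j ∧ c.val + 2 = j) ∨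
       (r = c ∧ r.val + 2 ≠ j ∧ r.val + 1 ≠ j) then 1 else 0

/-- The generating set `X = {t_i : i ∈ ℤ} ∪ {s_j : 3 ≤ j ≤ n}`. -/
def Xset (n : ℕ) : Set (Matrix (Fin n) (Fin n) (RatFunc ℚ)) :=
  {w | (∃ i : ℤ, w = tMat n i) ∨ (∃ j : ℕ, 3 ≤ j ∧ j ≤ n ∧ w = sMat n j)}

/-- `len n w` is the minimal `m` such that `w` is a product of `m` elements of `X`. -/
noncomputable def len (n : ℕ) (w : Matrix (Fin n) (Fin n) (RatFunc ℚ)) : ℕ :=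
  sInf {m | ∃ L : List (Matrix (Fin n) (Fin n) (RatFunc ℚ)),
    L.length = m ∧ (∀ a ∈ L, a ∈ Xset n) ∧ L.prod = w}

/-- Left divisibility: `v ⪯ w` iff `ℓ(v) + ℓ(v⁻¹ w) = ℓ(w)`. -/
def preL (n : ℕ) (v w : Matrix (Fin n) (Fin n) (RatFunc ℚ)) : Prop :=
  len n v + len n (v⁻¹ * w) = len n w

/-- Right divisibility: `v ⪯_r w` iff `ℓ(w v⁻¹) + ℓ(v) = ℓ(w)`. -/
def preR (n : ℕ) (v w : Matrix (Fin n) (Fin n) (RatFunc ℚ)) : Prop :=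
  len n (w * v⁻¹) + len n v = len n w

/-- The element `λ = diag(x^{-(n-1)}, x, …, x)`. -/
noncomputable def lam (n : ℕ) : Matrix (Fin n) (Fin n) (RatFunc ℚ) :=
  Matrix.diagonal (fun i => if i.val = 0 then xx ^ (-((n : ℤ) - 1)) else xx)

/-- The interval `[1, λ^k]` of left divisors of `λ^k`. -/
noncomputable def intervalL (n : ℕ) (k : ℤ) : Set (Matrix (Fin n) (Fin n) (RatFunc ℚ)) :=
  {v | preL n v ((lam n) ^ k)}

/-- The interval `[1, λ^k]_r` of right divisors of `λ^k`. -/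
noncomputable def intervalR (n : ℕ) (k : ℤ) : Set (Matrix (Fin n) (Fin n) (RatFunc ℚ)) :=
  {v | preR n v ((lam n) ^ k)}

/-- `m` is a least upper bound of `u` and `v` in the poset `([1,λ^k], ⪯)`. -/
noncomputable def IsLubL (n : ℕ) (k : ℤ)
    (u v m : Matrix (Fin n) (Fin n) (RatFunc ℚ)) : Prop :=
  m ∈ intervalL n k ∧ preL n u m ∧ preL n v m ∧
    ∀ z ∈ intervalL n k, preL n u z → preL n v z → preL n m z

/-- `m` is a least upper bound of `u` and `v` in the poset `([1,λ^k]_r, ⪯_r)`. -/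
noncomputable def IsLubR (n : ℕ) (k : ℤ)
    (u v m : Matrix (Fin n) (Fin n) (RatFunc ℚ)) : Prop :=
  m ∈ intervalR n k ∧ preR n u m ∧ preR n v m ∧
    ∀ z ∈ intervalR n k, preR n u z → preR n v z → preR n m z

/-- The monomial matrix whose row `r` has the single nonzero entry `x ^ (a r)` in column `c r`. -/
noncomputable def mon {n : ℕ} (c : Fin n → Fin n) (a : Fin n → ℤ) :
    Matrix (Fin n) (Fin n) (RatFunc ℚ) :=
  fun r j => if c r = j then xx ^ a r else 0

lemma xx_ne_zero : xx ≠ 0 := RatFunc.X_ne_zero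

lemma xx_pow_eq_one {m : ℕ} (h : xx ^ m = 1) : m = 0 := by
  have h1 : algebraMap (Polynomial ℚ) (RatFunc ℚ) (Polynomial.X ^ m) =
      algebraMap (Polynomial ℚ) (RatFunc ℚ) 1 := by
    rw [map_pow, RatFunc.algebraMap_X, map_one]; exact h
  have h2 := congrArg Polynomial.natDegree (RatFunc.algebraMap_injective ℚ h1)
  simpa using h2

lemma xx_zpow_injective {k l : ℤ} (h : xx ^ k = xx ^ l) : k = l := by
  wlog hkl : l ≤ k generalizing k l
  · exact (this h.symm (by omega)).symm
  obtain ⟨m, hm⟩ := Int.eq_ofNat_of_zero_le (sub_nonneg.2 hkl)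
  have h1 : xx ^ (k - l) = 1 := by
    rw [zpow_sub₀ xx_ne_zero, h, div_self (zpow_ne_zero _ xx_ne_zero)]
  rw [hm, zpow_natCast] at h1
  have := xx_pow_eq_one h1
  omega

lemma mon_mul {n : ℕ} (c c' : Fin n → Fin n) (a a' : Fin n → ℤ) :
    mon c a * mon c' a' = mon (c' ∘ c) (fun r => a r + a' (c r)) := by
  ext r j
  rw [Matrix.mul_apply, Finset.sum_eq_single (c r)]
  · simp [mon, zpow_add₀ xx_ne_zero]
  · intro l _ hl
    simp [mon, hl.symm]
  · simp

lemma mon_id_zero {n : ℕ} : mon (id : Fin n → Fin n) 0 = 1 := by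
  ext r j
  simp [mon, Matrix.one_apply]

lemma mon_injective {n : ℕ} {c c' : Fin n → Fin n} {a a' : Fin n → ℤ}
    (h : mon c a = mon c' a') : c = c' ∧ a = a' := by
  have key : ∀ r, c r = c' r ∧ a r = a' r := by
    intro r
    have h1 := congrFun (congrFun h r) (c r)
    have h0 : xx ^ a r ≠ 0 := zpow_ne_zero _ xx_ne_zero
    by_cases hc : c' r = c r
    · simp only [mon, hc, if_true] at h1
      exact ⟨hc.symm, xx_zpow_injective h1⟩
    · simp only [mon, hc, if_true, if_false] at h1
      exact absurd h1 h0
  exact ⟨funext fun r => (key r).1, funext fun r => (key r).2⟩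

/-! ### The combinatorial length -/

/-- Contribution to the length of a pair of rows with columns `c`, `c'`, the lower one having
exponent `a'`. -/
def pairLen {n : ℕ} (c c' : Fin n) (a' : ℤ) : ℕ :=
  if a' = 0 then (if c' < c then 1 else 0) else (if c < c' then 2 else 1)

/-- The combinatorial length of a monomial matrix. -/
def ell {n : ℕ} (c : Fin n → Fin n) (a : Fin n → ℤ) : ℕ :=
  ∑ i, ∑ j, if i < j then pairLen (c i) (c j) (a j) else 0

/-- The signed column of a row: positive exactly when the exponent vanishes. -/
def signedCol {n : ℕ} (c : Fin n) (a : ℤ) : ℤ :=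
  if a = 0 then (c : ℤ) + 1 else -((c : ℤ) + 1)

lemma pairLen_eq_add_one {n : ℕ} {c c' : Fin n} {a a' : ℤ} (hc : c ≠ c')
    (h : signedCol c' a' < signedCol c a) : pairLen c c' a' = pairLen c' c a + 1 := by
  have hc' : (c : ℕ) ≠ c' := fun e => hc (Fin.ext e)
  simp only [pairLen, signedCol, Fin.lt_def] at *
  split_ifs at * <;> omega

lemma signedCol_ne {n : ℕ} {c c' : Fin n} (a a' : ℤ) (hc : c ≠ c') :
    signedCol c a ≠ signedCol c' a' := by
  have hc' : (c : ℕ) ≠ c' := fun e => hc (Fin.ext e)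
  simp only [signedCol]
  split_ifs <;> omega

section

variable {N : ℕ}

/-- The transposition of the adjacent indices `p` and `p + 1`. -/
def adj (p : Fin (N + 1)) : Equiv.Perm (Fin (N + 2)) := Equiv.swap p.castSucc p.succ

lemma adj_castSucc (p : Fin (N + 1)) : adj p p.castSucc = p.succ := Equiv.swap_apply_left _ _

lemma adj_succ (p : Fin (N + 1)) : adj p p.succ = p.castSucc := Equiv.swap_apply_right _ _

lemma adj_of_ne {p : Fin (N + 1)} {r : Fin (N + 2)} (h1 : r ≠ p.castSucc) (h2 : r ≠ p.succ) :
    adj p r = r := Equiv.swap_apply_of_ne_of_ne h1 h2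

lemma adj_mul_self (p : Fin (N + 1)) : adj p * adj p = 1 := Equiv.swap_mul_self _ _

lemma sum_adj (p : Fin (N + 1)) (g : Fin (N + 2) → Fin (N + 2) → ℕ) :
    (∑ i, ∑ j, if i < j then g (adj p i) (adj p j) else 0) + g p.castSucc p.succ =
      (∑ i, ∑ j, if i < j then g i j else 0) + g p.succ p.castSucc := by
  have hinv : ∀ r, adj p (adj p r) = r := fun r => by simp [adj]
  have h1 : (∑ i, ∑ j, if i < j then g (adj p i) (adj p j) else 0) =
      ∑ i, ∑ j, if adj p i < adj p j then g i j else 0 := by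
    rw [← Equiv.sum_comp (adj p)]
    refine Finset.sum_congr rfl fun i _ => ?_
    rw [← Equiv.sum_comp (adj p)]
    refine Finset.sum_congr rfl fun j _ => ?_
    rw [hinv, hinv]
  have h2 : ∀ a b : Fin (N + 2), g a b =
      ∑ i, ∑ j, if i = a ∧ j = b then g i j else 0 := by
    intro a b
    rw [Finset.sum_eq_single a, Finset.sum_eq_single b] <;> simp +contextual
  rw [h1, h2 p.castSucc p.succ, h2 p.succ p.castSucc]
  simp only [← Finset.sum_add_distrib]
  refine Finset.sum_congr rfl fun i _ => Finset.sum_congr rfl fun j _ => ?_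
  clear h1 h2 hinv
  have hcs : (p.castSucc : ℕ) = p := Fin.val_castSucc p
  have hs : (p.succ : ℕ) = p + 1 := Fin.val_succ p
  have hv : ∀ r : Fin (N + 2), (r = p.castSucc ∧ adj p r = p.succ) ∨
      (r = p.succ ∧ adj p r = p.castSucc) ∨
      (r ≠ p.castSucc ∧ r ≠ p.succ ∧ adj p r = r) := by
    intro r
    by_cases h : r = p.castSucc
    · exact Or.inl ⟨h, h ▸ adj_castSucc p⟩
    by_cases h' : r = p.succ
    · exact Or.inr (Or.inl ⟨h', h' ▸ adj_succ p⟩)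
    · exact Or.inr (Or.inr ⟨h, h', adj_of_ne h h'⟩)
  rcases hv i with ⟨hi, hi'⟩ | ⟨hi, hi'⟩ | ⟨hi, hi1, hi'⟩ <;>
  rcases hv j with ⟨hj, hj'⟩ | ⟨hj, hj'⟩ | ⟨hj, hj1, hj'⟩ <;>
  rw [hi', hj'] <;> clear hi' hj' <;>
  simp only [Fin.ext_iff, Fin.lt_def] at * <;>
  split_ifs <;> omega

lemma ell_adj (p : Fin (N + 1)) (c : Fin (N + 2) → Fin (N + 2)) (b : Fin (N + 2) → ℤ) :
    ell (c ∘ adj p) (b ∘ adj p) + pairLen (c p.castSucc) (c p.succ) (b p.succ) =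
      ell c b + pairLen (c p.succ) (c p.castSucc) (b p.castSucc) :=
  sum_adj p fun i j => pairLen (c i) (c j) (b j)

lemma ell_adj_of_lt {p : Fin (N + 1)} {c : Fin (N + 2) → Fin (N + 2)} {b : Fin (N + 2) → ℤ}
    (hc : Function.Injective c)
    (h : signedCol (c p.succ) (b p.succ) < signedCol (c p.castSucc) (b p.castSucc)) :
    ell (c ∘ adj p) (b ∘ adj p) + 1 = ell c b := by
  have h1 := ell_adj p c b
  have h2 := pairLen_eq_add_one (hc.ne (Fin.castSucc_lt_succ (i := p)).ne) h
  omega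

lemma ell_adj_of_gt {p : Fin (N + 1)} {c : Fin (N + 2) → Fin (N + 2)} {b : Fin (N + 2) → ℤ}
    (hc : Function.Injective c)
    (h : signedCol (c p.castSucc) (b p.castSucc) < signedCol (c p.succ) (b p.succ)) :
    ell (c ∘ adj p) (b ∘ adj p) = ell c b + 1 := by
  have h1 := ell_adj p c b
  have h2 := pairLen_eq_add_one (hc.ne (Fin.castSucc_lt_succ (i := p)).ne') h
  omega

/-- The exponent vector `(i, 0, …, 0)`. -/
def delta (i : ℤ) : Fin (N + 2) → ℤ := fun r => if r = 0 then i else 0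

lemma ell_congr {c : Fin (N + 2) → Fin (N + 2)} {a b : Fin (N + 2) → ℤ}
    (h : ∀ r, r ≠ 0 → a r = b r) : ell c a = ell c b := by
  refine Finset.sum_congr rfl fun i _ => Finset.sum_congr rfl fun j _ => ?_
  split_ifs with hij
  · rw [h j (Fin.pos_iff_ne_zero.1 (lt_of_le_of_lt (Fin.zero_le i) hij))]
  · rfl

lemma ell_add_delta (c : Fin (N + 2) → Fin (N + 2)) (a : Fin (N + 2) → ℤ) (i : ℤ) :
    ell c (a + delta i) = ell c a :=
  ell_congr fun r hr => by simp [delta, hr]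

lemma ell_sub_delta (c : Fin (N + 2) → Fin (N + 2)) (a : Fin (N + 2) → ℤ) (i : ℤ) :
    ell c (a - delta i) = ell c a :=
  ell_congr fun r hr => by simp [delta, hr]

/-! ### Generators -/

/-- The permutation matrix of `σ` conjugated by `diag(x^(-i), 1, …, 1)`. -/
noncomputable def conjPerm (i : ℤ) (σ : Equiv.Perm (Fin (N + 2))) :
    Matrix (Fin (N + 2)) (Fin (N + 2)) (RatFunc ℚ) :=
  mon σ (delta i ∘ σ - delta i)

lemma conjPerm_mul_mon (i : ℤ) (σ : Equiv.Perm (Fin (N + 2))) (c : Fin (N + 2) → Fin (N + 2))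
    (a : Fin (N + 2) → ℤ) :
    conjPerm i σ * mon c a = mon (c ∘ σ) ((a + delta i) ∘ σ - delta i) := by
  rw [conjPerm, mon_mul]
  congr 1
  ext r
  simp only [Pi.sub_apply, Function.comp_apply, Pi.add_apply]
  ring

lemma conjPerm_mul (i : ℤ) (σ τ : Equiv.Perm (Fin (N + 2))) :
    conjPerm i σ * conjPerm i τ = conjPerm i (τ * σ) := by
  rw [conjPerm.eq_1 i τ, conjPerm_mul_mon, conjPerm, sub_add_cancel]
  rfl

lemma conjPerm_one (i : ℤ) : conjPerm (N := N) i 1 = 1 := by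
  rw [conjPerm, ← mon_id_zero]
  congr 1
  simp

/-- The generators, uniformly indexed by an adjacent pair of rows and an integer. -/
noncomputable def gen (p : Fin (N + 1)) (i : ℤ) :
    Matrix (Fin (N + 2)) (Fin (N + 2)) (RatFunc ℚ) :=
  conjPerm i (adj p)

lemma gen_mul_self (p : Fin (N + 1)) (i : ℤ) : gen p i * gen p i = 1 := by
  rw [gen, conjPerm_mul, adj_mul_self, conjPerm_one]

lemma gen_inv (p : Fin (N + 1)) (i : ℤ) : (gen p i)⁻¹ = gen p i :=
  Matrix.inv_eq_right_inv (gen_mul_self p i)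

lemma adj_zero_right {p : Fin (N + 1)} (hp : p ≠ 0) : adj p 0 = 0 :=
  adj_of_ne (fun h => hp (Fin.ext (congrArg Fin.val h).symm)) (Fin.succ_ne_zero p).symm

lemma gen_eq_gen {p : Fin (N + 1)} (hp : p ≠ 0) (i j : ℤ) : gen p i = gen p j := by
  have h : ∀ l : ℤ, delta l ∘ adj p = delta l := by
    intro l
    ext r
    have : adj p r = 0 ↔ r = 0 := by
      conv_lhs => rw [← adj_zero_right hp]
      exact (adj p).injective.eq_iff
    simp [delta, this]
  simp only [gen, conjPerm, h, sub_self]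

lemma gen_zero (i : ℤ) : gen (N := N) 0 i = tMat (N + 2) i := by
  ext r j
  by_cases h0 : r = 0
  · subst h0
    have : adj (N := N) 0 0 = 1 := adj_castSucc 0
    simp only [gen, conjPerm, mon, this, tMat, Fin.ext_iff]
    by_cases hj : (j : ℕ) = 1
    · simp [hj, delta, this]
    · have : ¬ 1 = (j : ℕ) := fun e => hj e.symm
      simp [hj, this]
  by_cases h1 : r = 1
  · subst h1
    have : adj (N := N) 0 1 = 0 := adj_succ 0
    simp only [gen, conjPerm, mon, this, tMat, Fin.ext_iff]
    by_cases hj : (j : ℕ) = 0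
    · simp [hj, delta, this]
    · have : ¬ 0 = (j : ℕ) := fun e => hj e.symm
      simp [hj, this]
  · have h2 : adj 0 r = r := adj_of_ne h0 h1
    simp only [Fin.ext_iff, Fin.val_zero, Fin.val_one] at h0 h1
    have h3 : 2 ≤ (r : ℕ) := by omega
    simp [gen, conjPerm, mon, tMat, h2, h0, h1, h3]

lemma gen_eq_sMat {p : Fin (N + 1)} (hp : p ≠ 0) (i : ℤ) :
    gen p i = sMat (N + 2) (p + 2) := by
  rw [gen_eq_gen hp i 0]
  have hd : delta (N := N) 0 = 0 := by ext r; simp [delta]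
  ext r j
  simp only [gen, conjPerm, mon, hd, sMat]
  by_cases h : r = p.castSucc
  · subst h
    simp [adj_castSucc, Fin.ext_iff, eq_comm]
  by_cases h' : r = p.succ
  · subst h'
    simp [adj_succ, Fin.ext_iff, eq_comm]
  · rw [adj_of_ne h h']
    simp only [Fin.ext_iff, Fin.val_succ, Fin.val_castSucc] at h h'
    simp [Fin.ext_iff, h, h']

lemma mem_Xset_iff {u : Matrix (Fin (N + 2)) (Fin (N + 2)) (RatFunc ℚ)} :
    u ∈ Xset (N + 2) ↔ ∃ p i, u = gen p i := by
  constructor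
  · rintro (⟨i, rfl⟩ | ⟨j, hj, hjn, rfl⟩)
    · exact ⟨0, i, (gen_zero i).symm⟩
    · refine ⟨⟨j - 2, by omega⟩, 0, ?_⟩
      rw [gen_eq_sMat (by simp [Fin.ext_iff]; omega)]
      congr 1
      simp only
      omega
  · rintro ⟨p, i, rfl⟩
    by_cases hp : p = 0
    · exact Or.inl ⟨i, by rw [hp, gen_zero]⟩
    · refine Or.inr ⟨p + 2, ?_, ?_, gen_eq_sMat hp i⟩
      · have : (p : ℕ) ≠ 0 := fun e => hp (Fin.ext e)
        omega
      · omega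

lemma gen_mem_Xset (p : Fin (N + 1)) (i : ℤ) : gen p i ∈ Xset (N + 2) :=
  mem_Xset_iff.2 ⟨p, i, rfl⟩

/-! ### The length function on products of generators -/

lemma len_le {n : ℕ} {L : List (Matrix (Fin n) (Fin n) (RatFunc ℚ))}
    (hL : ∀ a ∈ L, a ∈ Xset n) : len n L.prod ≤ L.length :=
  Nat.sInf_le ⟨L, rfl, hL, rfl⟩

lemma exists_list_len {n : ℕ} {w : Matrix (Fin n) (Fin n) (RatFunc ℚ)}
    (hw : w ∈ Submonoid.closure (Xset n)) :
    ∃ L : List (Matrix (Fin n) (Fin n) (RatFunc ℚ)),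
      L.length = len n w ∧ (∀ a ∈ L, a ∈ Xset n) ∧ L.prod = w := by
  obtain ⟨L, hL, hw⟩ := Submonoid.exists_list_of_mem_closure hw
  exact Nat.sInf_mem (s := {m | ∃ L : List (Matrix (Fin n) (Fin n) (RatFunc ℚ)),
    L.length = m ∧ (∀ a ∈ L, a ∈ Xset n) ∧ L.prod = w}) ⟨_, L, rfl, hL, hw⟩

lemma len_eq_zero_of_notMem {n : ℕ} {w : Matrix (Fin n) (Fin n) (RatFunc ℚ)}
    (hw : w ∉ Submonoid.closure (Xset n)) : len n w = 0 := by
  refine Nat.sInf_eq_zero.2 (Or.inr (Set.eq_empty_of_forall_notMem ?_))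
  rintro m ⟨L, -, hL, rfl⟩
  exact hw (Submonoid.list_prod_mem _ fun a ha => Submonoid.subset_closure (hL a ha))

lemma len_mul_le {n : ℕ} {v w : Matrix (Fin n) (Fin n) (RatFunc ℚ)}
    (hv : v ∈ Submonoid.closure (Xset n)) (hw : w ∈ Submonoid.closure (Xset n)) :
    len n (v * w) ≤ len n v + len n w := by
  obtain ⟨L, hl, hL, rfl⟩ := exists_list_len hv
  obtain ⟨L', hl', hL', rfl⟩ := exists_list_len hw
  rw [← hl, ← hl', ← List.length_append, ← List.prod_append]
  exact len_le fun a ha => (List.mem_append.1 ha).elim (hL a) (hL' a)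

lemma len_one {n : ℕ} : len n 1 = 0 :=
  Nat.le_zero.1 (len_le (L := []) (by simp))

lemma len_le_one {n : ℕ} {u : Matrix (Fin n) (Fin n) (RatFunc ℚ)} (hu : u ∈ Xset n) :
    len n u ≤ 1 := by
  simpa using len_le (L := [u]) (by simpa using hu)

lemma Xset_inv {u : Matrix (Fin (N + 2)) (Fin (N + 2)) (RatFunc ℚ)} (hu : u ∈ Xset (N + 2)) :
    u⁻¹ = u := by
  obtain ⟨p, i, rfl⟩ := mem_Xset_iff.1 hu
  exact gen_inv p i

lemma Xset_mul_self {u : Matrix (Fin (N + 2)) (Fin (N + 2)) (RatFunc ℚ)}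
    (hu : u ∈ Xset (N + 2)) : u * u = 1 := by
  obtain ⟨p, i, rfl⟩ := mem_Xset_iff.1 hu
  exact gen_mul_self p i

lemma list_prod_inv {L : List (Matrix (Fin (N + 2)) (Fin (N + 2)) (RatFunc ℚ))}
    (hL : ∀ a ∈ L, a ∈ Xset (N + 2)) : L.prod⁻¹ = L.reverse.prod ∧ IsUnit L.prod := by
  induction L with
  | nil => simp
  | cons a L ih =>
    have ha := hL a (by simp)
    obtain ⟨h1, h2⟩ := ih fun b hb => hL b (by simp [hb])
    refine ⟨?_, ?_⟩
    · rw [List.prod_cons, Matrix.mul_inv_rev, h1, Xset_inv ha]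
      simp
    · rw [List.prod_cons]
      exact (IsUnit.of_mul_eq_one a (Xset_mul_self ha)).mul h2

lemma isUnit_of_mem {w : Matrix (Fin (N + 2)) (Fin (N + 2)) (RatFunc ℚ)}
    (hw : w ∈ Submonoid.closure (Xset (N + 2))) : IsUnit w := by
  obtain ⟨L, -, hL, rfl⟩ := exists_list_len hw
  exact (list_prod_inv hL).2

lemma inv_mem {w : Matrix (Fin (N + 2)) (Fin (N + 2)) (RatFunc ℚ)}
    (hw : w ∈ Submonoid.closure (Xset (N + 2))) :
    w⁻¹ ∈ Submonoid.closure (Xset (N + 2)) ∧ len (N + 2) w⁻¹ ≤ len (N + 2) w := by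
  obtain ⟨L, hl, hL, rfl⟩ := exists_list_len hw
  have hL' : ∀ a ∈ L.reverse, a ∈ Xset (N + 2) := by simpa using hL
  rw [(list_prod_inv hL).1, ← hl, ← List.length_reverse]
  exact ⟨Submonoid.list_prod_mem _ fun a ha => Submonoid.subset_closure (hL' a ha), len_le hL'⟩

lemma inv_inv_of_isUnit {n : ℕ} {w : Matrix (Fin n) (Fin n) (RatFunc ℚ)} (hw : IsUnit w) :
    w⁻¹⁻¹ = w :=
  Matrix.nonsing_inv_nonsing_inv w ((Matrix.isUnit_iff_isUnit_det w).1 hw)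

lemma isUnit_of_inv_mem {w : Matrix (Fin (N + 2)) (Fin (N + 2)) (RatFunc ℚ)}
    (hw : w⁻¹ ∈ Submonoid.closure (Xset (N + 2))) : IsUnit w :=
  Matrix.isUnit_nonsing_inv_iff.1 (isUnit_of_mem hw)

lemma len_inv (w : Matrix (Fin (N + 2)) (Fin (N + 2)) (RatFunc ℚ)) :
    len (N + 2) w⁻¹ = len (N + 2) w := by
  by_cases hw : w ∈ Submonoid.closure (Xset (N + 2))
  · refine le_antisymm (inv_mem hw).2 ?_
    have := (inv_mem (inv_mem hw).1).2
    rwa [inv_inv_of_isUnit (isUnit_of_mem hw)] at this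
  · have hw' : w⁻¹ ∉ Submonoid.closure (Xset (N + 2)) := fun h => hw <| by
      have := (inv_mem h).1
      rwa [inv_inv_of_isUnit (isUnit_of_inv_mem h)] at this
    rw [len_eq_zero_of_notMem hw, len_eq_zero_of_notMem hw']

lemma sum_act (i : ℤ) (σ : Equiv.Perm (Fin (N + 2))) (a : Fin (N + 2) → ℤ) :
    ∑ r, ((a + delta i) ∘ σ - delta i : Fin (N + 2) → ℤ) r = ∑ r, a r := by
  simp only [Pi.sub_apply, Finset.sum_sub_distrib, Function.comp_apply]
  rw [Equiv.sum_comp σ (a + delta i)]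
  simp [Finset.sum_add_distrib]

lemma gen_mul_mon (p : Fin (N + 1)) (i : ℤ) (c : Fin (N + 2) → Fin (N + 2))
    (a : Fin (N + 2) → ℤ) :
    gen p i * mon c a = mon (c ∘ adj p) ((a + delta i) ∘ adj p - delta i) :=
  conjPerm_mul_mon i _ c a

lemma exists_mon_of_list {L : List (Matrix (Fin (N + 2)) (Fin (N + 2)) (RatFunc ℚ))}
    (hL : ∀ a ∈ L, a ∈ Xset (N + 2)) :
    ∃ c a, Function.Injective c ∧ ∑ r, a r = 0 ∧ L.prod = mon c a ∧ ell c a ≤ L.length := by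
  induction L with
  | nil =>
    refine ⟨id, 0, Function.injective_id, by simp, by rw [mon_id_zero, List.prod_nil], ?_⟩
    refine (Finset.sum_eq_zero fun i _ => Finset.sum_eq_zero fun j _ => ?_).le
    split_ifs with h
    · simp [pairLen, h.le]
    · rfl
  | cons u L ih =>
    obtain ⟨c, a, hc, ha, hp, hl⟩ := ih fun b hb => hL b (by simp [hb])
    obtain ⟨p, i, rfl⟩ := mem_Xset_iff.1 (hL u (by simp))
    refine ⟨_, _, hc.comp (adj p).injective, (sum_act i (adj p) a).trans ha, ?_, ?_⟩
    · rw [List.prod_cons, hp, gen_mul_mon]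
    · rw [ell_sub_delta, List.length_cons]
      have h1 := ell_add_delta c a i
      rcases lt_or_gt_of_ne (signedCol_ne ((a + delta i : Fin (N + 2) → ℤ) p.castSucc)
        ((a + delta i : Fin (N + 2) → ℤ) p.succ)
        (hc.ne (Fin.castSucc_lt_succ (i := p)).ne)) with h | h
      · have := ell_adj_of_gt hc h
        omega
      · have := ell_adj_of_lt hc h
        omega

lemma exists_descent {c : Fin (N + 2) → Fin (N + 2)} {a : Fin (N + 2) → ℤ}
    (hc : Function.Injective c) (ha : ∑ r, a r = 0) (h : mon c a ≠ 1) :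
    ∃ p i, ell (c ∘ adj p) ((a + delta i) ∘ adj p) + 1 = ell c a := by
  by_contra! hno
  have key : ∀ (p : Fin (N + 1)) (i : ℤ),
      signedCol (c p.castSucc) ((a + delta i : Fin (N + 2) → ℤ) p.castSucc) <
        signedCol (c p.succ) ((a + delta i : Fin (N + 2) → ℤ) p.succ) := by
    intro p i
    by_contra hlt
    have h1 := lt_of_le_of_ne (not_lt.1 hlt) (signedCol_ne _ _
      (hc.ne (Fin.castSucc_lt_succ (i := p)).ne'))
    exact hno p i ((ell_adj_of_lt hc h1).trans (ell_add_delta c a i))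
  have hmono : StrictMono fun r => signedCol (c r) ((a + delta (-a 0) : Fin (N + 2) → ℤ) r) :=
    Fin.strictMono_iff_lt_succ.2 fun p => key p _
  have hzero : ∀ r, (a + delta (-a 0) : Fin (N + 2) → ℤ) r = 0 := by
    intro r
    have h0 : (a + delta (-a 0) : Fin (N + 2) → ℤ) 0 = 0 := by simp [delta]
    have h1 := hmono.monotone (Fin.zero_le r)
    by_contra hr
    simp only [h0, signedCol, hr, if_true, if_false] at h1
    omega
  have hcm : StrictMono c := by
    intro r s hrs
    have h1 := hmono hrs
    simp only [hzero, signedCol, if_true] at h1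
    exact Fin.lt_def.2 (by omega)
  have hid : c = id := by
    have := Subsingleton.elim (hcm.orderIsoOfSurjective c (Finite.surjective_of_injective hc))
      (OrderIso.refl _)
    exact funext fun r => congrArg (fun f : Fin (N + 2) ≃o Fin (N + 2) => f r) this
  have ha0 : a 0 = 0 := by
    have h1 : ∑ r, (a + delta (-a 0) : Fin (N + 2) → ℤ) r = 0 := Finset.sum_eq_zero fun r _ => hzero r
    simpa [Finset.sum_add_distrib, ha, delta] using h1
  apply h
  rw [hid, ← mon_id_zero]
  congr 1
  ext r
  have := hzero r
  simpa [delta, ha0] using this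

lemma mem_closure_of_mon {c : Fin (N + 2) → Fin (N + 2)} {a : Fin (N + 2) → ℤ}
    (hc : Function.Injective c) (ha : ∑ r, a r = 0) :
    mon c a ∈ Submonoid.closure (Xset (N + 2)) ∧ len (N + 2) (mon c a) ≤ ell c a := by
  induction hl : ell c a using Nat.strong_induction_on generalizing c a with
  | _ m ih =>
    by_cases h : mon c a = 1
    · rw [h, len_one]
      exact ⟨one_mem _, Nat.zero_le _⟩
    obtain ⟨p, i, hpi⟩ := exists_descent hc ha h
    have h1 := ih _ (by omega) (hc.comp (adj p).injective) ((sum_act i (adj p) a).trans ha)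
      (ell_sub_delta _ _ i)
    rw [← gen_mul_mon] at h1
    have h2 : mon c a = gen p i * (gen p i * mon c a) := by
      rw [← mul_assoc, gen_mul_self, one_mul]
    have h3 : gen p i ∈ Submonoid.closure (Xset (N + 2)) :=
      Submonoid.subset_closure (gen_mem_Xset p i)
    rw [h2]
    refine ⟨mul_mem h3 h1.1, (len_mul_le h3 h1.1).trans ?_⟩
    have := len_le_one (gen_mem_Xset p i)
    omega

theorem len_mon {c : Fin (N + 2) → Fin (N + 2)} {a : Fin (N + 2) → ℤ}
    (hc : Function.Injective c) (ha : ∑ r, a r = 0) : len (N + 2) (mon c a) = ell c a := by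
  obtain ⟨hmem, hle⟩ := mem_closure_of_mon hc ha
  refine le_antisymm hle ?_
  obtain ⟨L, hl, hL, hp⟩ := exists_list_len hmem
  obtain ⟨c', a', -, -, hp', hl'⟩ := exists_mon_of_list hL
  obtain ⟨rfl, rfl⟩ := mon_injective (hp.symm.trans hp')
  omega

lemma exists_mon_of_mem {w : Matrix (Fin (N + 2)) (Fin (N + 2)) (RatFunc ℚ)}
    (hw : w ∈ Submonoid.closure (Xset (N + 2))) :
    ∃ c a, Function.Injective c ∧ ∑ r, a r = 0 ∧ w = mon c a := by
  obtain ⟨L, -, hL, rfl⟩ := exists_list_len hw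
  obtain ⟨c, a, hc, ha, h, -⟩ := exists_mon_of_list hL
  exact ⟨c, a, hc, ha, h⟩

/-! ### The powers of `λ` -/

/-- The exponents of the diagonal entries of `λ`. -/
def lamExp : Fin (N + 2) → ℤ := fun r => if r = 0 then -((N : ℤ) + 1) else 1

lemma sum_lamExp : ∑ r, lamExp (N := N) r = 0 := by
  rw [Fin.sum_univ_succ]
  simp [lamExp, Fin.succ_ne_zero]

lemma sum_smul_lamExp (k : ℤ) : ∑ r, (k • lamExp (N := N)) r = 0 := by
  simp only [Pi.smul_apply, ← Finset.smul_sum, sum_lamExp, smul_zero]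

lemma mon_id_mul (a : Fin (N + 2) → ℤ) (c : Fin (N + 2) → Fin (N + 2)) (b : Fin (N + 2) → ℤ) :
    mon id a * mon c b = mon c (a + b) :=
  mon_mul _ _ _ _

lemma mon_id_inv (a : Fin (N + 2) → ℤ) : (mon id a)⁻¹ = mon id (-a) :=
  Matrix.inv_eq_right_inv (by rw [mon_id_mul, add_neg_cancel, mon_id_zero])

lemma lam_eq : lam (N + 2) = mon id lamExp := by
  ext r j
  have h : -(((N + 2 : ℕ) : ℤ) - 1) = -((N : ℤ) + 1) := by push_cast; ring
  have h' : (r : ℕ) = 0 ↔ r = 0 := Fin.val_eq_zero_iff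
  by_cases hrj : r = j
  · subst hrj
    by_cases hr : r = 0
    · subst hr
      simp only [lam, Matrix.diagonal_apply_eq, mon, lamExp, h, Fin.val_zero, id, if_true]
    · simp only [lam, Matrix.diagonal_apply_eq, mon, lamExp, h', hr, id, if_true, if_false,
        zpow_one]
  · simp [lam, mon, hrj]

lemma lam_zpow (k : ℤ) : lam (N + 2) ^ k = mon id (k • lamExp) := by
  have hnat : ∀ m : ℕ, lam (N + 2) ^ m = mon id ((m : ℤ) • lamExp) := by
    intro m
    induction m with
    | zero => simp [mon_id_zero]
    | succ m ih =>
      rw [pow_succ, ih, lam_eq, mon_id_mul]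
      congr 1
      push_cast
      rw [add_smul, one_smul]
  obtain ⟨m, rfl | rfl⟩ := k.eq_nat_or_neg
  · rw [zpow_natCast, hnat]
  · rw [Matrix.zpow_neg_natCast, hnat, mon_id_inv, neg_smul]

lemma lam_zpow_mem (k : ℤ) : lam (N + 2) ^ k ∈ Submonoid.closure (Xset (N + 2)) := by
  rw [lam_zpow]
  exact (mem_closure_of_mon Function.injective_id (sum_smul_lamExp k)).1

lemma lam_zpow_neg (k : ℤ) : lam (N + 2) ^ (-k) = (lam (N + 2) ^ k)⁻¹ := by
  rw [lam_zpow, lam_zpow, mon_id_inv, neg_smul]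

lemma smul_lamExp_of_ne (k : ℤ) {r : Fin (N + 2)} (hr : r ≠ 0) : (k • lamExp) r = k := by
  simp [lamExp, hr]

lemma len_lam_zpow {k : ℤ} (hk : k ≠ 0) :
    len (N + 2) (lam (N + 2) ^ k) =
      ∑ i : Fin (N + 2), ∑ j : Fin (N + 2), if i < j then 2 else 0 := by
  rw [lam_zpow, len_mon Function.injective_id (sum_smul_lamExp k)]
  refine Finset.sum_congr rfl fun i _ => Finset.sum_congr rfl fun j _ => ?_
  split_ifs with hij
  · have : j ≠ 0 := (lt_of_le_of_lt (Fin.zero_le i) hij).ne'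
    rw [smul_lamExp_of_ne k this, pairLen, if_neg hk, id, id, if_pos hij]
  · rfl

lemma len_lam_zpow_pos {k : ℤ} (hk : k ≠ 0) : 0 < len (N + 2) (lam (N + 2) ^ k) := by
  rw [len_lam_zpow hk]
  refine Finset.sum_pos' (fun _ _ => Nat.zero_le _) ⟨0, Finset.mem_univ _, ?_⟩
  exact Finset.sum_pos' (fun _ _ => Nat.zero_le _) ⟨1, Finset.mem_univ _, by simp⟩

lemma mem_closure_of_mem_intervalL {k : ℤ} (hk : k ≠ 0)
    {z : Matrix (Fin (N + 2)) (Fin (N + 2)) (RatFunc ℚ)} (hz : z ∈ intervalL (N + 2) k) :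
    z ∈ Submonoid.closure (Xset (N + 2)) := by
  by_contra hmem
  have h : len (N + 2) z + len (N + 2) (z⁻¹ * lam (N + 2) ^ k) = len (N + 2) (lam (N + 2) ^ k) :=
    hz
  have hnot : z⁻¹ * lam (N + 2) ^ k ∉ Submonoid.closure (Xset (N + 2)) := by
    intro h1
    have h2 : z⁻¹ ∈ Submonoid.closure (Xset (N + 2)) := by
      have h3 := mul_mem h1 (inv_mem (lam_zpow_mem k)).1
      rwa [Matrix.mul_nonsing_inv_cancel_right _ _
        ((Matrix.isUnit_iff_isUnit_det _).1 (isUnit_of_mem (lam_zpow_mem k)))] at h3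
    have h4 := (inv_mem h2).1
    rw [inv_inv_of_isUnit (isUnit_of_inv_mem h2)] at h4
    exact hmem h4
  have := len_lam_zpow_pos (N := N) hk
  rw [len_eq_zero_of_notMem hmem, len_eq_zero_of_notMem hnot] at h
  omega

/-- In an element of the interval, the second row has exponent `0` or `k` unless it lies to the
left of the first. -/
lemma exponent_of_mem_intervalL {k : ℤ} (hk : k ≠ 0) {c : Fin (N + 2) → Fin (N + 2)}
    {a : Fin (N + 2) → ℤ} (hc : Function.Injective c) (ha : ∑ r, a r = 0)
    (hz : mon c a ∈ intervalL (N + 2) k) (hlt : c 0 < c 1) : a 1 = 0 ∨ a 1 = k := by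
  have h : len (N + 2) (mon c a) + len (N + 2) ((mon c a)⁻¹ * lam (N + 2) ^ k) =
    len (N + 2) (lam (N + 2) ^ k) := hz
  have hinv : (lam (N + 2) ^ k)⁻¹ * mon c a = mon c ((-k) • lamExp + a) := by
    rw [← lam_zpow_neg, lam_zpow, mon_id_mul]
  have hu := isUnit_of_mem (mem_closure_of_mon hc ha).1
  have hmem : ∑ r, ((-k) • lamExp + a : Fin (N + 2) → ℤ) r = 0 := by
    simp only [Pi.add_apply, Finset.sum_add_distrib, sum_smul_lamExp, ha, add_zero]
  rw [← len_inv ((mon c a)⁻¹ * _), Matrix.mul_inv_rev, inv_inv_of_isUnit hu, hinv,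
    len_mon hc hmem, len_mon hc ha, len_lam_zpow hk] at h
  simp only [ell, ← Finset.sum_add_distrib] at h
  have hle : ∀ i j : Fin (N + 2), (if i < j then 2 else 0) ≤
      (if i < j then pairLen (c i) (c j) (a j) else 0) +
        (if i < j then pairLen (c i) (c j) (((-k) • lamExp + a : Fin (N + 2) → ℤ) j) else 0) := by
    intro i j
    split_ifs with hij
    · have hj : j ≠ 0 := (lt_of_le_of_lt (Fin.zero_le i) hij).ne'
      have hcij : (c i : ℕ) ≠ c j := fun e => hij.ne (hc (Fin.ext e))
      rw [Pi.add_apply, smul_lamExp_of_ne _ hj]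
      simp only [pairLen, Fin.lt_def]
      split_ifs <;> omega
    · exact Nat.zero_le _
  have h1 := (Finset.sum_eq_sum_iff_of_le fun i _ => Finset.sum_le_sum fun j _ => hle i j).1 h.symm
    0 (Finset.mem_univ _)
  have h2 := (Finset.sum_eq_sum_iff_of_le fun j _ => hle 0 j).1 h1 1 (Finset.mem_univ _)
  rw [Pi.add_apply, smul_lamExp_of_ne _ (one_ne_zero)] at h2
  simp only [pairLen, Fin.lt_def] at h2 hlt
  by_contra! hcon
  have hne : -k + a 1 ≠ 0 := fun e => hcon.2 (by omega)
  simp only [Fin.val_zero, Fin.val_one, hcon.1, hne, hlt, zero_lt_one, if_true, if_false] at h2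
  omega

/-! ### Least common multiples of generators -/

lemma len_conjPerm_mul_mon (i : ℤ) (σ : Equiv.Perm (Fin (N + 2)))
    {c : Fin (N + 2) → Fin (N + 2)} {a : Fin (N + 2) → ℤ}
    (hc : Function.Injective c) (ha : ∑ r, a r = 0) :
    len (N + 2) (conjPerm i σ * mon c a) = ell (c ∘ σ) ((a + delta i) ∘ σ) := by
  rw [conjPerm_mul_mon, len_mon (hc.comp σ.injective) ((sum_act i σ a).trans ha), ell_sub_delta]

lemma len_gen_mul_mon {p : Fin (N + 1)} {i : ℤ} {c : Fin (N + 2) → Fin (N + 2)}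
    {a : Fin (N + 2) → ℤ} (hc : Function.Injective c) (ha : ∑ r, a r = 0)
    (h : signedCol (c p.succ) ((a + delta i : Fin (N + 2) → ℤ) p.succ) <
      signedCol (c p.castSucc) ((a + delta i : Fin (N + 2) → ℤ) p.castSucc)) :
    len (N + 2) (gen p i * mon c a) + 1 = len (N + 2) (mon c a) := by
  rw [gen, len_conjPerm_mul_mon i _ hc ha, len_mon hc ha, ell_adj_of_lt hc h, ell_add_delta]

lemma lt_of_preL_gen {p : Fin (N + 1)} {i : ℤ} {c : Fin (N + 2) → Fin (N + 2)}
    {a : Fin (N + 2) → ℤ} (hc : Function.Injective c) (ha : ∑ r, a r = 0)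
    (h : preL (N + 2) (gen p i) (mon c a)) :
    signedCol (c p.succ) ((a + delta i : Fin (N + 2) → ℤ) p.succ) <
      signedCol (c p.castSucc) ((a + delta i : Fin (N + 2) → ℤ) p.castSucc) := by
  by_contra hlt
  have h1 := ell_adj_of_gt hc (lt_of_le_of_ne (not_lt.1 hlt)
    (signedCol_ne _ _ (hc.ne (Fin.castSucc_lt_succ (i := p)).ne)))
  rw [preL, gen_inv, gen, len_conjPerm_mul_mon i _ hc ha, len_mon hc ha] at h
  rw [ell_add_delta] at h1
  omega

lemma preL_gen_lam {k : ℤ} (hk : k ≠ 0) {u : Matrix (Fin (N + 2)) (Fin (N + 2)) (RatFunc ℚ)}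
    (hu : u ∈ Xset (N + 2)) : preL (N + 2) u (lam (N + 2) ^ k) := by
  obtain ⟨p, i, rfl⟩ := mem_Xset_iff.1 hu
  have h : len (N + 2) (gen p i * lam (N + 2) ^ k) + 1 = len (N + 2) (lam (N + 2) ^ k) := by
    rw [lam_zpow]
    refine len_gen_mul_mon Function.injective_id (sum_smul_lamExp k) ?_
    rw [Pi.add_apply, smul_lamExp_of_ne k (Fin.succ_ne_zero p)]
    simp only [delta, Fin.succ_ne_zero, if_false, add_zero, id, signedCol, if_neg hk,
      Fin.val_succ, Fin.val_castSucc]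
    split_ifs <;> push_cast <;> omega
  have h1 := len_mul_le (Submonoid.subset_closure hu)
    (mul_mem (Submonoid.subset_closure hu) (lam_zpow_mem k))
  rw [← mul_assoc, Xset_mul_self hu, one_mul] at h1
  have h2 := len_le_one hu
  rw [preL, Xset_inv hu]
  omega

lemma isLubL_of_len {k : ℤ} (hk : k ≠ 0)
    {u v m : Matrix (Fin (N + 2)) (Fin (N + 2)) (RatFunc ℚ)} {d : ℕ}
    (hu : u ∈ Xset (N + 2)) (hv : v ∈ Xset (N + 2))
    (hm : m ∈ Submonoid.closure (Xset (N + 2))) (hmd : len (N + 2) m ≤ d)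
    (hum : len (N + 2) (u * m) + 1 ≤ d) (hvm : len (N + 2) (v * m) + 1 ≤ d)
    (H : ∀ c a, Function.Injective c → ∑ r, a r = 0 → mon c a ∈ intervalL (N + 2) k →
      preL (N + 2) u (mon c a) → preL (N + 2) v (mon c a) →
        len (N + 2) (m⁻¹ * mon c a) + d = len (N + 2) (mon c a)) :
    IsLubL (N + 2) k u v m := by
  have hdet : ∀ {w : Matrix (Fin (N + 2)) (Fin (N + 2)) (RatFunc ℚ)},
      w ∈ Submonoid.closure (Xset (N + 2)) → IsUnit w.det := fun hw =>
    (Matrix.isUnit_iff_isUnit_det _).1 (isUnit_of_mem hw)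
  have hlam : lam (N + 2) ^ k ∈ intervalL (N + 2) k := by
    change len _ _ + len _ _ = len _ _
    rw [Matrix.nonsing_inv_mul _ (hdet (lam_zpow_mem k)), len_one, add_zero]
  have H' : ∀ z ∈ intervalL (N + 2) k, preL (N + 2) u z → preL (N + 2) v z →
      len (N + 2) (m⁻¹ * z) + d = len (N + 2) z := by
    intro z hz huz hvz
    obtain ⟨c, a, hc, ha, rfl⟩ := exists_mon_of_mem (mem_closure_of_mem_intervalL hk hz)
    exact H c a hc ha hz huz hvz
  have h1 := H' _ hlam (preL_gen_lam hk hu) (preL_gen_lam hk hv)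
  have h2 := len_mul_le hm (mul_mem (inv_mem hm).1 (lam_zpow_mem k))
  rw [Matrix.mul_nonsing_inv_cancel_left _ _ (hdet hm)] at h2
  have hd : len (N + 2) m = d := by omega
  have hdiv : ∀ w ∈ Xset (N + 2), len (N + 2) (w * m) + 1 ≤ d → preL (N + 2) w m := by
    intro w hw hwm
    have h3 := len_mul_le (Submonoid.subset_closure hw)
      (mul_mem (Submonoid.subset_closure hw) hm)
    rw [← mul_assoc, Xset_mul_self hw, one_mul] at h3
    have h4 := len_le_one hw
    rw [preL, Xset_inv hw]
    omega
  have hpre : ∀ z ∈ intervalL (N + 2) k, preL (N + 2) u z → preL (N + 2) v z →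
      preL (N + 2) m z := by
    intro z hz huz hvz
    have := H' z hz huz hvz
    rw [preL]
    omega
  exact ⟨hpre _ hlam (preL_gen_lam hk hu) (preL_gen_lam hk hv), hdiv u hu hum, hdiv v hv hvm,
    hpre⟩

lemma preR_iff_preL_inv (v w : Matrix (Fin (N + 2)) (Fin (N + 2)) (RatFunc ℚ)) :
    preR (N + 2) v w ↔ preL (N + 2) v⁻¹ w⁻¹ := by
  rw [preR, preL, ← Matrix.mul_inv_rev, len_inv, len_inv, len_inv, add_comm]

lemma isLubR_of_isLubL {k : ℤ} {u v m : Matrix (Fin (N + 2)) (Fin (N + 2)) (RatFunc ℚ)}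
    (hu : u ∈ Xset (N + 2)) (hv : v ∈ Xset (N + 2)) (h : IsLubL (N + 2) (-k) u v m⁻¹) :
    IsLubR (N + 2) k u v m := by
  have hint : ∀ z, z ∈ intervalR (N + 2) k ↔ z⁻¹ ∈ intervalL (N + 2) (-k) := by
    intro z
    change preR _ _ _ ↔ preL _ _ _
    rw [preR_iff_preL_inv, lam_zpow_neg]
  obtain ⟨h1, h2, h3, h4⟩ := h
  refine ⟨(hint m).2 h1, ?_, ?_, fun z hz huz hvz => ?_⟩
  · rwa [preR_iff_preL_inv, Xset_inv hu]
  · rwa [preR_iff_preL_inv, Xset_inv hv]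
  · rw [preR_iff_preL_inv, Xset_inv hu] at huz
    rw [preR_iff_preL_inv, Xset_inv hv] at hvz
    exact (preR_iff_preL_inv m z).2 (h4 _ ((hint z).1 hz) huz hvz)

lemma len_gen_mul_gen (p q : Fin (N + 1)) (i j : ℤ) :
    gen p i * gen q j ∈ Submonoid.closure (Xset (N + 2)) ∧
      len (N + 2) (gen p i * gen q j) ≤ 2 := by
  have hp := Submonoid.subset_closure (gen_mem_Xset p i)
  have hq := Submonoid.subset_closure (gen_mem_Xset q j)
  refine ⟨mul_mem hp hq, (len_mul_le hp hq).trans ?_⟩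
  have h1 := len_le_one (gen_mem_Xset p i)
  have h2 := len_le_one (gen_mem_Xset q j)
  omega

lemma adj_braid {p q : Fin (N + 1)} (h : p.succ = q.castSucc) :
    adj p * adj q * adj p = adj q * adj p * adj q := by
  have h01 : p.castSucc ≠ q.castSucc := h ▸ (Fin.castSucc_lt_succ (i := p)).ne
  have h12 : q.succ ≠ q.castSucc := (Fin.castSucc_lt_succ (i := q)).ne'
  have h02 : p.castSucc ≠ q.succ :=
    ((Fin.castSucc_lt_succ (i := p)).trans (h ▸ Fin.castSucc_lt_succ (i := q))).ne
  rw [adj, adj, h, Equiv.swap_mul_swap_mul_swap h01 h02, Equiv.swap_comm p.castSucc q.castSucc,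
    Equiv.swap_comm q.castSucc q.succ, Equiv.swap_mul_swap_mul_swap h12 h02.symm]
  exact Equiv.swap_comm _ _

lemma adj_commute {p q : Fin (N + 1)} (h : p.succ < q.castSucc) :
    adj p * adj q = adj q * adj p := by
  refine (Equiv.Perm.Disjoint.commute fun r => ?_).eq
  by_cases hr : r < q.castSucc
  · exact Or.inr (adj_of_ne hr.ne (hr.trans Fin.castSucc_lt_succ).ne)
  · have hr' := h.trans_le (not_lt.1 hr)
    exact Or.inl (adj_of_ne (Fin.castSucc_lt_succ.trans hr').ne' hr'.ne')

lemma isLubL_braid {k : ℤ} (hk : k ≠ 0) {p q : Fin (N + 1)} (h : p.succ = q.castSucc) (i : ℤ) :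
    IsLubL (N + 2) k (gen p i) (gen q i) (gen p i * gen q i * gen p i) := by
  have hpq : gen p i * gen q i * gen p i = gen q i * gen p i * gen q i := by
    simp only [gen, conjPerm_mul]
    rw [← mul_assoc, adj_braid h, mul_assoc]
  have hp := gen_mem_Xset p i
  have hq := gen_mem_Xset q i
  have h2 := len_gen_mul_gen p q i i
  refine isLubL_of_len (d := 3) hk hp hq (mul_mem h2.1 (Submonoid.subset_closure hp)) ?_ ?_ ?_ ?_
  · have h3 := len_mul_le h2.1 (Submonoid.subset_closure hp)
    have h4 := len_le_one hp
    omega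
  · rw [mul_assoc, ← mul_assoc, gen_mul_self, one_mul]
    exact Nat.succ_le_succ (len_gen_mul_gen q p i i).2
  · rw [hpq, mul_assoc, ← mul_assoc, gen_mul_self, one_mul]
    exact Nat.succ_le_succ h2.2
  · intro c a hc ha _ hpz hqz
    have hlt1 := lt_of_preL_gen hc ha hpz
    have hlt2 := lt_of_preL_gen hc ha hqz
    have hinv : (gen p i * gen q i * gen p i)⁻¹ = conjPerm i (adj p * adj q * adj p) := by
      rw [Matrix.mul_inv_rev, Matrix.mul_inv_rev, gen_inv, gen_inv]
      simp only [gen, conjPerm_mul]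
    rw [hinv, len_conjPerm_mul_mon i _ hc ha, len_mon hc ha, ← ell_add_delta c a i]
    generalize a + delta i = b at hlt1 hlt2 ⊢
    have hx0 : adj q p.castSucc = p.castSucc := by
      refine adj_of_ne ?_ ?_
      · exact h ▸ (Fin.castSucc_lt_succ (i := p)).ne
      · exact ((Fin.castSucc_lt_succ (i := p)).trans (h ▸ Fin.castSucc_lt_succ (i := q))).ne
    have hx2 : adj p q.succ = q.succ := by
      refine adj_of_ne ?_ ?_
      · exact ((Fin.castSucc_lt_succ (i := p)).trans (h ▸ Fin.castSucc_lt_succ (i := q))).ne'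
      · exact h ▸ (Fin.castSucc_lt_succ (i := q)).ne'
    have hx1 : adj p q.castSucc = p.castSucc := h ▸ adj_succ p
    have hx1' : adj q p.succ = q.succ := h ▸ adj_castSucc q
    have hstep1 := ell_adj_of_lt hc hlt1
    have hstep2 := ell_adj_of_lt (p := q) (b := b ∘ adj p) (hc.comp (adj p).injective) (by
      simp only [Function.comp_apply, hx1, hx2]
      exact hlt2.trans (h ▸ hlt1))
    have hstep3 := ell_adj_of_lt (p := p) (b := (b ∘ adj p) ∘ adj q)
      ((hc.comp (adj p).injective).comp (adj q).injective) (by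
        simp only [Function.comp_apply, hx0, hx1', hx2, adj_castSucc]
        rw [h]
        exact hlt2)
    have hfin : ell (c ∘ (adj p * adj q * adj p : Equiv.Perm _))
        (b ∘ (adj p * adj q * adj p : Equiv.Perm _)) =
        ell (((c ∘ adj p) ∘ adj q) ∘ adj p) (((b ∘ adj p) ∘ adj q) ∘ adj p) := rfl
    omega

lemma isLubL_commute {k : ℤ} (hk : k ≠ 0) {p q : Fin (N + 1)} (h : p.succ < q.castSucc) (i : ℤ) :
    IsLubL (N + 2) k (gen p i) (gen q i) (gen p i * gen q i) := by
  have hpq : gen p i * gen q i = gen q i * gen p i := by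
    simp only [gen, conjPerm_mul, adj_commute h]
  have hp := gen_mem_Xset p i
  have hq := gen_mem_Xset q i
  have h2 := len_gen_mul_gen p q i i
  refine isLubL_of_len (d := 2) hk hp hq h2.1 h2.2 ?_ ?_ ?_
  · rw [← mul_assoc, gen_mul_self, one_mul]
    exact Nat.succ_le_succ (len_le_one hq)
  · rw [hpq, ← mul_assoc, gen_mul_self, one_mul]
    exact Nat.succ_le_succ (len_le_one hp)
  · intro c a hc ha _ hpz hqz
    have hlt1 := lt_of_preL_gen hc ha hpz
    have hlt2 := lt_of_preL_gen hc ha hqz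
    have hinv : (gen p i * gen q i)⁻¹ = conjPerm i (adj p * adj q) := by
      rw [Matrix.mul_inv_rev, gen_inv, gen_inv]
      simp only [gen, conjPerm_mul]
    rw [hinv, len_conjPerm_mul_mon i _ hc ha, len_mon hc ha, ← ell_add_delta c a i]
    generalize a + delta i = b at hlt1 hlt2 ⊢
    have hx : ∀ r, p.succ < r → adj p r = r := fun r hr =>
      adj_of_ne (Fin.castSucc_lt_succ.trans hr).ne' hr.ne'
    have hstep1 := ell_adj_of_lt hc hlt1
    have hstep2 := ell_adj_of_lt (p := q) (b := b ∘ adj p) (hc.comp (adj p).injective) (by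
      simp only [Function.comp_apply, hx _ h, hx _ (h.trans Fin.castSucc_lt_succ)]
      exact hlt2)
    have hfin : ell (c ∘ (adj p * adj q : Equiv.Perm _)) (b ∘ (adj p * adj q : Equiv.Perm _)) =
        ell ((c ∘ adj p) ∘ adj q) ((b ∘ adj p) ∘ adj q) := rfl
    omega

lemma gen_zero_mul_gen_zero {i j i' j' : ℤ} (h : i - j = i' - j') :
    gen (N := N) 0 i * gen 0 j = gen 0 i' * gen 0 j' := by
  simp only [gen, conjPerm, mon_mul]
  congr 1
  ext r
  have hr : adj 0 (adj (N := N) 0 r) = r := Equiv.congr_fun (adj_mul_self 0) r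
  simp only [Pi.sub_apply, Function.comp_apply, hr, delta]
  split_ifs <;> omega

lemma isLubL_gen_zero {k : ℤ} (hk : k ≠ 0) {i j : ℤ} (hij : i ≠ j) :
    IsLubL (N + 2) k (gen 0 i) (gen 0 j) (gen 0 k * gen 0 0) := by
  have hform : ∀ l : ℤ, gen (N := N) 0 k * gen 0 0 = gen 0 l * gen 0 (l - k) := fun l =>
    gen_zero_mul_gen_zero (by ring)
  have hdiv : ∀ l : ℤ, len (N + 2) (gen 0 l * (gen 0 k * gen 0 0)) + 1 ≤ 2 := by
    intro l
    rw [hform l, ← mul_assoc, gen_mul_self, one_mul]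
    exact Nat.succ_le_succ (len_le_one (gen_mem_Xset _ _))
  have h2 := len_gen_mul_gen (N := N) 0 0 k 0
  refine isLubL_of_len hk (gen_mem_Xset _ _) (gen_mem_Xset _ _) h2.1 h2.2 (hdiv i) (hdiv j) ?_
  intro c a hc ha hz hpz hqz
  have hlt1 := lt_of_preL_gen hc ha hpz
  have hlt2 := lt_of_preL_gen hc ha hqz
  have hstep1 := len_gen_mul_mon hc ha hlt1
  have hcols : c 0 < c 1 ∧ a 1 ≠ 0 := by
    simp only [Fin.castSucc_zero, Fin.succ_zero_eq_one, Pi.add_apply, delta, one_ne_zero,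
      if_true, if_false, add_zero, signedCol] at hlt1 hlt2
    rw [Fin.lt_def]
    split_ifs at hlt1 hlt2 <;> constructor <;> omega
  have hak := (exponent_of_mem_intervalL hk hc ha hz hcols.1).resolve_left hcols.2
  have hstep2 := len_gen_mul_mon (p := 0) (i := i - k) (hc.comp (adj 0).injective)
    ((sum_act i (adj 0) a).trans ha) (by
      have e0 : adj (N := N) 0 0 = 1 := adj_castSucc 0
      have e1 : adj (N := N) 0 1 = 0 := adj_succ 0
      have hcol := Fin.lt_def.1 hcols.1
      simp only [Fin.castSucc_zero, Fin.succ_zero_eq_one, Pi.add_apply, Pi.sub_apply,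
        Function.comp_apply, e0, e1, delta, one_ne_zero, if_true, if_false, signedCol, hak]
      split_ifs <;> omega)
  rw [← gen_mul_mon] at hstep2
  rw [hform i, Matrix.mul_inv_rev, gen_inv, gen_inv, mul_assoc]
  omega

lemma IsLubL.symm {n : ℕ} {k : ℤ} {u v m : Matrix (Fin n) (Fin n) (RatFunc ℚ)}
    (h : IsLubL n k u v m) : IsLubL n k v u m :=
  ⟨h.1, h.2.2.1, h.2.1, fun z hz hv hu => h.2.2.2 z hz hu hv⟩

lemma exists_isLubL_of_lt {p q : Fin (N + 1)} (hpq : p < q) (i j : ℤ) :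
    ∃ m : Matrix (Fin (N + 2)) (Fin (N + 2)) (RatFunc ℚ), m⁻¹ = m ∧
      ∀ k : ℤ, k ≠ 0 → IsLubL (N + 2) k (gen p i) (gen q j) m := by
  have hq : gen q j = gen q i := gen_eq_gen (Fin.ne_zero_of_lt hpq) j i
  rw [hq]
  have hle : p.succ ≤ q.castSucc := Fin.succ_le_castSucc_iff.2 hpq
  rcases hle.eq_or_lt with h | h
  · refine ⟨_, ?_, fun k hk => isLubL_braid hk h i⟩
    rw [Matrix.mul_inv_rev, Matrix.mul_inv_rev, gen_inv, gen_inv, mul_assoc]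
  · refine ⟨_, ?_, fun k hk => isLubL_commute hk h i⟩
    rw [Matrix.mul_inv_rev, gen_inv, gen_inv]
    simp only [gen, conjPerm_mul, adj_commute h]

lemma exists_isLubL {u v : Matrix (Fin (N + 2)) (Fin (N + 2)) (RatFunc ℚ)}
    (hu : u ∈ Xset (N + 2)) (hv : v ∈ Xset (N + 2)) (huv : u ≠ v) :
    ∃ m : ℤ → Matrix (Fin (N + 2)) (Fin (N + 2)) (RatFunc ℚ), (∀ k, (m k)⁻¹ = m (-k)) ∧
      ∀ k : ℤ, k ≠ 0 → IsLubL (N + 2) k u v (m k) := by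
  obtain ⟨p, i, rfl⟩ := mem_Xset_iff.1 hu
  obtain ⟨q, j, rfl⟩ := mem_Xset_iff.1 hv
  rcases lt_trichotomy p q with h | rfl | h
  · obtain ⟨m, hm, hlub⟩ := exists_isLubL_of_lt h i j
    exact ⟨fun _ => m, fun _ => hm, hlub⟩
  · have hp : p = 0 := by
      by_contra hp
      exact huv (gen_eq_gen hp i j)
    subst hp
    have hij : i ≠ j := fun e => huv (e ▸ rfl)
    refine ⟨fun k => gen 0 k * gen 0 0, fun k => ?_, fun k hk => isLubL_gen_zero hk hij⟩
    simp only
    rw [Matrix.mul_inv_rev, gen_inv, gen_inv]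
    exact gen_zero_mul_gen_zero (by ring)
  · obtain ⟨m, hm, hlub⟩ := exists_isLubL_of_lt h j i
    exact ⟨fun _ => m, fun _ => hm, fun k hk => (hlub k hk).symm⟩

end

/-- any two distinct generators have a least upper bound in
`([1,λ^k]_r, ⪯_r)`, which coincides with their least upper bound in `([1,λ^k], ⪯)`. -/
theorem stmt_7 (n : ℕ) (hn : 2 ≤ n) (k : ℤ) (hk : k ≠ 0) :
    ∀ u ∈ Xset n, ∀ v ∈ Xset n, u ≠ v →
      ∃ m, IsLubR n k u v m ∧ IsLubL n k u v m := by
  intro u hu v hv huv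
  obtain ⟨N, rfl⟩ : ∃ N, n = N + 2 := ⟨n - 2, by omega⟩
  obtain ⟨m, hinv, hlub⟩ := exists_isLubL hu hv huv
  refine ⟨m k, isLubR_of_isLubL hu hv ?_, hlub k hk⟩
  rw [hinv]
  exact hlub (-k) (neg_ne_zero.2 hk)
end

section
/- For every n ≥ 2 and every nonzero integer k, any two elements a, b of the presented monoid B^{⊕k}(∞,∞,n) have a least common right multiple and a greatest common left divisor with respect to left divisibility (where u left-divides v iff v = u·w for some w), and likewise a least common left multiple and a greatest common right divisor with respect to right divisibility. -/
/-- Index type for the generators `s̃_3, …, s̃_n`. -/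
abbrev SIdx (n : ℕ) := {j : ℕ // 3 ≤ j ∧ j ≤ n}

/-- Generators of the Corran–Lee–Lee type presentations: `t̃_i` (`i ∈ ℤ`) and `s̃_j`
(`3 ≤ j ≤ n`). -/
abbrev Gen (n : ℕ) := ℤ ⊕ SIdx n

/-- The generator `t̃_i` as an element of the free monoid. -/
def tw (n : ℕ) (i : ℤ) : FreeMonoid (Gen n) := FreeMonoid.of (Sum.inl i)

/-- The generator `s̃_j` as an element of the free monoid. -/
def sw (n : ℕ) (j : SIdx n) : FreeMonoid (Gen n) := FreeMonoid.of (Sum.inr j)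

/-- The defining relations of the monoid `B^{⊕k}(∞,∞,n)`. -/
inductive BRel (n : ℕ) (k : ℤ) : FreeMonoid (Gen n) → FreeMonoid (Gen n) → Prop
  | braid (i j : SIdx n) (h : i.val + 1 = j.val ∨ j.val + 1 = i.val) :
      BRel n k (sw n i * sw n j * sw n i) (sw n j * sw n i * sw n j)
  | comm (i j : SIdx n) (h : i.val + 1 < j.val ∨ j.val + 1 < i.val) :
      BRel n k (sw n i * sw n j) (sw n j * sw n i)
  | ts3 (i : ℤ) (s3 : SIdx n) (h : s3.val = 3) :
      BRel n k (sw n s3 * tw n i * sw n s3) (tw n i * sw n s3 * tw n i)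
  | tsj (i : ℤ) (j : SIdx n) (h : 4 ≤ j.val) :
      BRel n k (sw n j * tw n i) (tw n i * sw n j)
  | tt (i j : ℤ) :
      BRel n k (tw n i * tw n (i - k)) (tw n j * tw n (j - k))

/-- The monoid `B^{⊕k}(∞,∞,n)`, presented by the generators `Gen n` and the relations
`BRel n k`. -/
abbrev BMon (n : ℕ) (k : ℤ) := (conGen (BRel n k)).Quotient

/-- The image in `B^{⊕k}(∞,∞,n)` of a word in the generators. -/
def bmk (n : ℕ) (k : ℤ) : FreeMonoid (Gen n) →* BMon n k := (conGen (BRel n k)).mk'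

section Words

variable {n : ℕ} {k : ℤ}

/-- Position of a generator on the Coxeter-type diagram; all `t̃_i` share position `2`. -/
def genPos : Gen n → ℕ
  | Sum.inl _ => 2
  | Sum.inr j => j.val

/-- The permutation of the generators sending `t̃_i` to `t̃_{i-k}` and fixing every `s̃_j`. -/
def genNext (k : ℤ) : Gen n → Gen n
  | Sum.inl i => Sum.inl (i - k)
  | Sum.inr j => Sum.inr j

/-- Two generators at distance at least two on the diagram. -/
abbrev GenFar (x y : Gen n) : Prop := genPos x + 1 < genPos y ∨ genPos y + 1 < genPos x

/-- Two generators at distance one on the diagram. -/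
abbrev GenAdj (x y : Gen n) : Prop := genPos x + 1 = genPos y ∨ genPos y + 1 = genPos x

/-- Two different generators at the same position. -/
abbrev GenTwin (x y : Gen n) : Prop := x ≠ y ∧ genPos x = genPos y

/-- The image of a generator in the monoid. -/
def bgen (n : ℕ) (k : ℤ) (x : Gen n) : BMon n k := bmk n k (FreeMonoid.of x)

theorem bmk_of (x : Gen n) : bmk n k (FreeMonoid.of x) = bgen n k x := rfl

@[simp] theorem genPos_genNext (x : Gen n) : genPos (genNext k x) = genPos x := by
  cases x <;> rfl

theorem genNext_injective : Function.Injective (genNext (n := n) k) := by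
  rintro (i | i) (j | j) h <;> simp [genNext] at h <;> simp [h]

theorem GenTwin.exists_inl {x y : Gen n} (h : GenTwin x y) :
    ∃ i j, x = Sum.inl i ∧ y = Sum.inl j := by
  obtain ⟨hne, hp⟩ := h
  rcases x with i | ⟨i, hi⟩ <;> rcases y with j | ⟨j, hj⟩ <;> simp [genPos] at hp hne ⊢ <;> omega

theorem GenTwin.genNext {x y : Gen n} (h : GenTwin x y) :
    GenTwin (genNext k x) (genNext k y) :=
  ⟨genNext_injective.ne h.1, by simpa using h.2⟩

theorem GenTwin.self_genNext {x y : Gen n} (h : GenTwin x y) (hk : k ≠ 0) :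
    GenTwin x (_root_.genNext k x) := by
  obtain ⟨i, j, rfl, rfl⟩ := h.exists_inl
  exact ⟨fun h => by simp only [_root_.genNext, Sum.inl.injEq] at h; omega, by simp⟩

theorem bmk_eq_of_rel {a b : FreeMonoid (Gen n)} (h : BRel n k a b) : bmk n k a = bmk n k b :=
  (Con.eq _).2 (ConGen.Rel.of _ _ h)

theorem bgen_far {x y : Gen n} (h : GenFar x y) :
    bgen n k x * bgen n k y = bgen n k y * bgen n k x := by
  simp only [bgen, ← map_mul]
  rcases x with i | i <;> rcases y with j | j
  · simp [GenFar, genPos] at h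
  · have := j.2.1
    simp only [GenFar, genPos] at h
    exact (bmk_eq_of_rel (BRel.tsj i j (by omega))).symm
  · have := i.2.1
    simp only [GenFar, genPos] at h
    exact bmk_eq_of_rel (BRel.tsj j i (by omega))
  · exact bmk_eq_of_rel (BRel.comm i j h)

theorem bgen_adj {x y : Gen n} (h : GenAdj x y) :
    bgen n k x * bgen n k y * bgen n k x = bgen n k y * bgen n k x * bgen n k y := by
  simp only [bgen, ← map_mul]
  rcases x with i | i <;> rcases y with j | j
  · simp [GenAdj, genPos] at h
  · have := j.2.1
    simp only [GenAdj, genPos] at h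
    exact (bmk_eq_of_rel (BRel.ts3 i j (by omega))).symm
  · have := i.2.1
    simp only [GenAdj, genPos] at h
    exact bmk_eq_of_rel (BRel.ts3 j i (by omega))
  · exact bmk_eq_of_rel (BRel.braid i j h)

theorem bgen_genNext {x y : Gen n} (h : GenTwin x y) :
    bgen n k x * bgen n k (genNext k x) = bgen n k y * bgen n k (genNext k y) := by
  obtain ⟨i, j, rfl, rfl⟩ := h.exists_inl
  simp only [bgen, ← map_mul]
  exact bmk_eq_of_rel (BRel.tt i j)

theorem bgen_far_assoc {x y : Gen n} (h : GenFar x y) (r : BMon n k) :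
    bgen n k x * (bgen n k y * r) = bgen n k y * (bgen n k x * r) := by
  rw [← mul_assoc, bgen_far h, mul_assoc]

theorem bgen_adj_assoc {x y : Gen n} (h : GenAdj x y) (r : BMon n k) :
    bgen n k x * (bgen n k y * (bgen n k x * r)) =
      bgen n k y * (bgen n k x * (bgen n k y * r)) := by
  simpa only [mul_assoc] using congrArg (· * r) (bgen_adj (k := k) h)

theorem bgen_genNext_assoc {x y : Gen n} (h : GenTwin x y) (r : BMon n k) :
    bgen n k x * (bgen n k (genNext k x) * r) = bgen n k y * (bgen n k (genNext k y) * r) := by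
  simpa only [mul_assoc] using congrArg (· * r) (bgen_genNext (k := k) h)

/-- The word length as a homomorphism. -/
def lenHom (n : ℕ) (k : ℤ) : BMon n k →* Multiplicative ℕ :=
  Con.lift (conGen (BRel n k)) (FreeMonoid.lift fun _ => Multiplicative.ofAdd 1) <| by
    rw [Con.conGen_le]
    intro a b h
    cases h <;> simp [Con.ker_rel, tw, sw]

/-- The word length of an element of the monoid. -/
def blen (a : BMon n k) : ℕ := (lenHom n k a).toAdd

@[simp] theorem blen_mul (a b : BMon n k) : blen (a * b) = blen a + blen b := by
  simp [blen]

@[simp] theorem blen_one : blen (1 : BMon n k) = 0 := by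
  simp [blen]

@[simp] theorem blen_bgen (x : Gen n) : blen (bgen n k x) = 1 := by
  change (FreeMonoid.lift (fun _ => Multiplicative.ofAdd 1) (FreeMonoid.of x)).toAdd = 1
  simp

theorem BMon.eq_one_or_eq_bgen_mul (a : BMon n k) : a = 1 ∨ ∃ x b, a = bgen n k x * b := by
  induction a using Con.induction_on with
  | H w =>
    cases w using FreeMonoid.casesOn with
    | one => exact Or.inl rfl
    | of_mul x w => exact Or.inr ⟨x, bmk n k w, rfl⟩

theorem eq_one_of_blen_eq_zero {a : BMon n k} (h : blen a = 0) : a = 1 := by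
  rcases a.eq_one_or_eq_bgen_mul with rfl | ⟨x, b, rfl⟩
  · rfl
  · simp at h

/-- `x · u` and `y · v` are obtained from the same right multiple of the elementary common
multiple of the generators `x` and `y`. -/
def HeadRel (x : Gen n) (u : BMon n k) (y : Gen n) (v : BMon n k) : Prop :=
  (x = y ∧ u = v) ∨
  (GenFar x y ∧ ∃ w, u = bgen n k y * w ∧ v = bgen n k x * w) ∨
  (GenAdj x y ∧ ∃ w, u = bgen n k y * (bgen n k x * w) ∧ v = bgen n k x * (bgen n k y * w)) ∨
  (GenTwin x y ∧ ∃ w, u = bgen n k (genNext k x) * w ∧ v = bgen n k (genNext k y) * w)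

namespace HeadRel

variable {x y z : Gen n} {u v w : BMon n k}

theorem symm (h : HeadRel x u y v) : HeadRel y v x u := by
  rcases h with ⟨h, h'⟩ | ⟨h, w, h1, h2⟩ | ⟨h, w, h1, h2⟩ | ⟨h, w, h1, h2⟩
  · exact Or.inl ⟨h.symm, h'.symm⟩
  · exact Or.inr (Or.inl ⟨h.symm, w, h2, h1⟩)
  · exact Or.inr (Or.inr (Or.inl ⟨h.symm, w, h2, h1⟩))
  · exact Or.inr (Or.inr (Or.inr ⟨⟨h.1.symm, h.2.symm⟩, w, h2, h1⟩))

theorem mul_right (h : HeadRel x u y v) (r : BMon n k) : HeadRel x (u * r) y (v * r) := by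
  rcases h with ⟨h, h'⟩ | ⟨h, w, h1, h2⟩ | ⟨h, w, h1, h2⟩ | ⟨h, w, h1, h2⟩
  · exact Or.inl ⟨h, by rw [h']⟩
  · exact Or.inr (Or.inl ⟨h, w * r, by simp only [h1, mul_assoc], by simp only [h2, mul_assoc]⟩)
  · exact Or.inr (Or.inr (Or.inl
      ⟨h, w * r, by simp only [h1, mul_assoc], by simp only [h2, mul_assoc]⟩))
  · exact Or.inr (Or.inr (Or.inr
      ⟨h, w * r, by simp only [h1, mul_assoc], by simp only [h2, mul_assoc]⟩))

end HeadRel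

/-- Equalities `x · u = y · v` with `u` shorter than `L` come from elementary common multiples. -/
def ReducesBelow (n : ℕ) (k : ℤ) (L : ℕ) : Prop :=
  ∀ (x : Gen n) (u : BMon n k) (y : Gen n) (v : BMon n k), blen u < L →
    bgen n k x * u = bgen n k y * v → HeadRel x u y v

namespace ReducesBelow

variable {L : ℕ} (H : ReducesBelow n k L) {x y z : Gen n} {p q u v w : BMon n k}

include H

theorem cancel (h : bgen n k x * p = bgen n k x * q) (hl : blen p < L) : p = q := by
  rcases H _ _ _ _ hl h with h | ⟨h, -⟩ | ⟨h, -⟩ | ⟨h, -⟩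
  · exact h.2
  · omega
  · omega
  · exact absurd rfl h.1

theorem far (hxy : GenFar x y) (h : bgen n k x * p = bgen n k y * q) (hl : blen p < L) :
    ∃ r, p = bgen n k y * r ∧ q = bgen n k x * r := by
  rcases H _ _ _ _ hl h with ⟨rfl, -⟩ | ⟨-, h⟩ | ⟨h, -⟩ | ⟨h, -⟩
  · omega
  · exact h
  · omega
  · have := h.2
    omega

theorem adj (hxy : GenAdj x y) (h : bgen n k x * p = bgen n k y * q) (hl : blen p < L) :
    ∃ r, p = bgen n k y * (bgen n k x * r) ∧ q = bgen n k x * (bgen n k y * r) := by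
  rcases H _ _ _ _ hl h with ⟨rfl, -⟩ | ⟨h, -⟩ | ⟨-, h⟩ | ⟨h, -⟩
  · omega
  · omega
  · exact h
  · have := h.2
    omega

theorem twin (hxy : GenTwin x y) (h : bgen n k x * p = bgen n k y * q) (hl : blen p < L) :
    ∃ r, p = bgen n k (genNext k x) * r ∧ q = bgen n k (genNext k y) * r := by
  have := hxy.2
  rcases H _ _ _ _ hl h with h | ⟨h, -⟩ | ⟨h, -⟩ | ⟨-, h⟩
  · exact absurd h.1 hxy.1
  · omega
  · omega
  · exact h

theorem trans_far_far (hxy : GenFar x y) (hyz : GenFar y z) (hl : blen p < L)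
    (h : bgen n k x * p = bgen n k z * q) :
    HeadRel x (bgen n k y * p) z (bgen n k y * q) := by
  rcases H _ _ _ _ hl h with ⟨rfl, rfl⟩ | ⟨hxz, r, rfl, rfl⟩ | ⟨hxz, r, rfl, rfl⟩ |
    ⟨hxz, r, rfl, rfl⟩
  · exact Or.inl ⟨rfl, rfl⟩
  · exact Or.inr (Or.inl ⟨hxz, bgen n k y * r, bgen_far_assoc hyz r, bgen_far_assoc hxy.symm r⟩)
  · refine Or.inr (Or.inr (Or.inl ⟨hxz, bgen n k y * r, ?_, ?_⟩))
    · rw [bgen_far_assoc hyz, bgen_far_assoc hxy.symm]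
    · rw [bgen_far_assoc hxy.symm, bgen_far_assoc hyz]
  · refine Or.inr (Or.inr (Or.inr ⟨hxz, bgen n k y * r, bgen_far_assoc ?_ r, bgen_far_assoc ?_ r⟩))
    · simpa [GenFar] using hxy.symm
    · simpa [GenFar] using hyz

theorem trans_far_adj (hxy : GenFar x y) (hyz : GenAdj y z) (hl : blen p < L)
    (h : bgen n k x * p = bgen n k z * (bgen n k y * q)) :
    HeadRel x (bgen n k y * p) z (bgen n k y * (bgen n k z * q)) := by
  have hlen := congrArg blen h
  simp only [blen_mul, blen_bgen] at hlen
  rcases H _ _ _ _ hl h with ⟨rfl, -⟩ | ⟨hxz, r, rfl, h1⟩ | ⟨hxz, r, rfl, h1⟩ | ⟨hxz, -⟩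
  · omega
  · simp only [blen_mul, blen_bgen] at hl hlen
    obtain ⟨r, rfl, rfl⟩ := H.far hxy.symm h1 (by omega)
    refine Or.inr (Or.inl ⟨hxz, bgen n k y * (bgen n k z * r), ?_, ?_⟩)
    · rw [bgen_adj_assoc hyz]
    · rw [bgen_far_assoc hxz.symm, bgen_far_assoc hxy.symm]
  · simp only [blen_mul, blen_bgen] at hl hlen
    obtain ⟨r', rfl, h2⟩ := H.far hxy.symm h1 (by omega)
    simp only [blen_mul, blen_bgen] at hl hlen
    obtain ⟨r', rfl, rfl⟩ := H.adj hyz.symm h2 (by omega)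
    refine Or.inr (Or.inr (Or.inl
      ⟨hxz, bgen n k y * (bgen n k z * (bgen n k x * r')), ?_, ?_⟩))
    · rw [bgen_far_assoc hxy, bgen_adj_assoc hyz, bgen_adj_assoc hxz.symm,
        bgen_far_assoc hxy.symm]
    · rw [← bgen_adj_assoc hyz, bgen_far_assoc hxy.symm r', bgen_far_assoc hxy (bgen n k z * _),
        bgen_adj_assoc hxz.symm]
  · have := hxz.2
    omega

theorem trans_adj_adj (hk : k ≠ 0) (hxy : GenAdj x y) (hyz : GenAdj y z) (hl : blen p + 1 < L)
    (h : bgen n k x * (bgen n k y * p) = bgen n k z * (bgen n k y * q)) :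
    HeadRel x (bgen n k y * (bgen n k x * p)) z (bgen n k y * (bgen n k z * q)) := by
  have hlen := congrArg blen h
  simp only [blen_mul, blen_bgen] at hlen
  rcases H _ _ _ _ (by simpa [add_comm] using hl) h with ⟨rfl, h1⟩ | ⟨hxz, r, h1, h2⟩ |
    ⟨hxz, -⟩ | ⟨hxz, r, h1, h2⟩
  · exact Or.inl ⟨rfl, by rw [H.cancel h1 (by omega)]⟩
  · obtain ⟨r1, rfl, rfl⟩ := H.adj hyz h1 (by omega)
    obtain ⟨r2, rfl, h3⟩ := H.adj hxy.symm h2 (by omega)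
    simp only [blen_mul, blen_bgen] at hl hlen
    have h4 := H.cancel h3 (by simp; omega)
    obtain ⟨r3, rfl, rfl⟩ := H.far hxz.symm h4 (by omega)
    refine Or.inr (Or.inl
      ⟨hxz, bgen n k y * (bgen n k z * (bgen n k x * (bgen n k y * r3))), ?_, ?_⟩)
    · rw [bgen_far_assoc hxz, bgen_adj_assoc hxy, bgen_adj_assoc hyz]
    · rw [bgen_far_assoc hxz.symm, bgen_adj_assoc hyz.symm, bgen_adj_assoc hxy.symm,
        bgen_far_assoc hxz (bgen n k y * r3)]
  · omega
  · have hx : GenAdj y (genNext k x) := by simpa [GenAdj] using hxy.symm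
    have hz : GenAdj y (genNext k z) := by simpa [GenAdj] using hyz
    have hx' : GenAdj y (genNext k (genNext k x)) := by simpa [GenAdj] using hxy.symm
    have hz' : GenAdj y (genNext k (genNext k z)) := by simpa [GenAdj] using hyz
    obtain ⟨r1, rfl, rfl⟩ := H.adj hx h1 (by omega)
    obtain ⟨r2, rfl, h3⟩ := H.adj hz h2 (by omega)
    simp only [blen_mul, blen_bgen] at hl hlen
    have h4 := H.cancel h3 (by simp; omega)
    obtain ⟨r3, rfl, rfl⟩ := H.twin hxz.genNext h4 (by omega)
    refine Or.inr (Or.inr (Or.inr ⟨hxz, bgen n k y * (bgen n k (genNext k x) *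
      (bgen n k (genNext k (genNext k x)) * (bgen n k y * r3))), ?_, ?_⟩))
    · rw [bgen_genNext_assoc (hxz.self_genNext hk), ← bgen_adj_assoc hx', bgen_adj_assoc hx]
    · rw [bgen_genNext_assoc (GenTwin.self_genNext ⟨hxz.1.symm, hxz.2.symm⟩ hk),
        ← bgen_adj_assoc hz', bgen_adj_assoc hz, bgen_genNext_assoc hxz.genNext]

theorem trans_far_twin (hxy : GenFar x y) (hyz : GenTwin y z) (hl : blen p < L)
    (h : bgen n k x * p = bgen n k (genNext k y) * q) :
    HeadRel x (bgen n k y * p) z (bgen n k (genNext k z) * q) := by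
  have hpos := hyz.2
  have hxz : GenFar x z := by omega
  obtain ⟨r, rfl, rfl⟩ := H.far (by simpa [GenFar] using hxy) h hl
  exact Or.inr (Or.inl ⟨hxz, bgen n k (genNext k z) * r, bgen_genNext_assoc hyz r,
    bgen_far_assoc (by simpa [GenFar] using hxz.symm) r⟩)

theorem trans_adj_twin (hk : k ≠ 0) (hxy : GenAdj x y) (hyz : GenTwin y z) (hl : blen p + 1 < L)
    (h : bgen n k x * (bgen n k y * p) = bgen n k (genNext k y) * q) :
    HeadRel x (bgen n k y * (bgen n k x * p)) z (bgen n k (genNext k z) * q) := by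
  have hpos := hyz.2
  have hxz : GenAdj x z := by omega
  have hy : GenAdj x (genNext k y) := by simpa [GenAdj] using hxy
  have hy' : GenAdj x (genNext k (genNext k y)) := by simpa [GenAdj] using hxy
  have hz : GenAdj x (genNext k z) := by simpa [GenAdj] using hxz
  have hz' : GenAdj x (genNext k (genNext k z)) := by simpa [GenAdj] using hxz
  have hlen := congrArg blen h
  simp only [blen_mul, blen_bgen] at hlen
  obtain ⟨r, h1, rfl⟩ := H.adj hy h (by simp; omega)
  obtain ⟨r1, rfl, h2⟩ := H.twin (hyz.self_genNext hk) h1 (by omega)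
  simp only [blen_mul, blen_bgen] at hl hlen
  obtain ⟨r2, rfl, rfl⟩ := H.adj hy' h2 (by omega)
  refine Or.inr (Or.inr (Or.inl ⟨hxz, bgen n k (genNext k z) * (bgen n k x *
    (bgen n k (genNext k (genNext k z)) * r2)), ?_, ?_⟩))
  · rw [bgen_adj_assoc hz, bgen_adj_assoc hy, bgen_genNext_assoc hyz.genNext,
      bgen_genNext_assoc hyz]
  · rw [bgen_genNext_assoc hyz.genNext, ← bgen_adj_assoc hz, bgen_adj_assoc hz',
      ← bgen_genNext_assoc
        (GenTwin.self_genNext (y := y) ⟨hyz.1.symm, hyz.2.symm⟩ hk)]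

theorem trans_twin_twin (hxy : GenTwin x y) (hyz : GenTwin y z) (hl : blen p < L)
    (h : bgen n k (genNext k y) * p = bgen n k (genNext k y) * q) :
    HeadRel x (bgen n k (genNext k x) * p) z (bgen n k (genNext k z) * q) := by
  obtain rfl := H.cancel h hl
  by_cases hxz : x = z
  · subst hxz
    exact Or.inl ⟨rfl, rfl⟩
  · exact Or.inr (Or.inr (Or.inr ⟨⟨hxz, hxy.2.trans hyz.2⟩, p, rfl, rfl⟩))

/-- The cube condition on the generators, in the form of transitivity of `HeadRel`. -/
theorem trans (hk : k ≠ 0) (hl : blen v ≤ L) (hxy : HeadRel x u y v) (hyz : HeadRel y v z w) :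
    HeadRel x u z w := by
  rcases hxy with ⟨rfl, rfl⟩ | ⟨hxy, p, rfl, rfl⟩ | ⟨hxy, p, rfl, rfl⟩ | ⟨hxy, p, rfl, rfl⟩
  · exact hyz
  all_goals
    simp only [blen_mul, blen_bgen] at hl
    rcases hyz with ⟨rfl, rfl⟩ | ⟨hyz, q, h, rfl⟩ | ⟨hyz, q, h, rfl⟩ | ⟨hyz, q, h, rfl⟩
  · exact Or.inr (Or.inl ⟨hxy, p, rfl, rfl⟩)
  · exact H.trans_far_far hxy hyz (by omega) h
  · exact H.trans_far_adj hxy hyz (by omega) h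
  · exact H.trans_far_twin hxy hyz (by omega) h
  · exact Or.inr (Or.inr (Or.inl ⟨hxy, p, rfl, rfl⟩))
  · have hlen := congrArg blen h
    simp only [blen_mul, blen_bgen] at hlen
    exact (H.trans_far_adj hyz.symm hxy.symm (by omega) h.symm).symm
  · exact H.trans_adj_adj hk hxy hyz (by omega) h
  · exact H.trans_adj_twin hk hxy hyz (by omega) h
  · exact Or.inr (Or.inr (Or.inr ⟨hxy, p, rfl, rfl⟩))
  all_goals
    have hlen := congrArg blen h
    simp only [blen_mul, blen_bgen] at hlen
    have hyx : GenTwin y x := ⟨hxy.1.symm, hxy.2.symm⟩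
  · exact (H.trans_far_twin hyz.symm hyx (by omega) h.symm).symm
  · exact (H.trans_adj_twin hk hyz.symm hyx (by omega) h.symm).symm
  · exact H.trans_twin_twin hxy hyz (by omega) h

end ReducesBelow

theorem FreeMonoid.of_mul_inj {α : Type*} {x y : α} {U V : FreeMonoid α}
    (h : FreeMonoid.of x * U = FreeMonoid.of y * V) : x = y ∧ U = V :=
  List.cons.inj h

theorem headRel_of_bRel {w w' : FreeMonoid (Gen n)} (h : BRel n k w w') {x y : Gen n}
    {U V : FreeMonoid (Gen n)} (hw : w = FreeMonoid.of x * U) (hw' : w' = FreeMonoid.of y * V) :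
    HeadRel x (bmk n k U) y (bmk n k V) := by
  cases h <;> simp only [tw, sw, mul_assoc] at hw hw' <;>
    obtain ⟨rfl, rfl⟩ := FreeMonoid.of_mul_inj hw <;>
    obtain ⟨rfl, rfl⟩ := FreeMonoid.of_mul_inj hw'
  case braid i j h => exact Or.inr (Or.inr (Or.inl ⟨h, 1, by simp [bgen], by simp [bgen]⟩))
  case comm i j h => exact Or.inr (Or.inl ⟨h, 1, by simp [bgen], by simp [bgen]⟩)
  case ts3 i j h =>
    exact Or.inr (Or.inr (Or.inl ⟨by simp [GenAdj, genPos, h], 1, by simp [bgen], by simp [bgen]⟩))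
  case tsj i j h =>
    exact Or.inr (Or.inl ⟨by simp only [GenFar, genPos]; omega, 1, by simp [bgen], by simp [bgen]⟩)
  case tt i j =>
    by_cases h : i = j
    · subst h
      exact Or.inl ⟨rfl, rfl⟩
    · exact Or.inr (Or.inr (Or.inr ⟨⟨by simpa using h, rfl⟩, 1, by simp [bgen, genNext],
        by simp [bgen, genNext]⟩))

theorem blen_bmk_eq {a b : FreeMonoid (Gen n)} (h : ConGen.Rel (BRel n k) a b) :
    blen (bmk n k a) = blen (bmk n k b) :=
  congrArg blen ((Con.eq _).2 h)

theorem ReducesBelow.headRel {L : ℕ} (hk : k ≠ 0) (H : ReducesBelow n k L)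
    {w w' : FreeMonoid (Gen n)} (h : ConGen.Rel (BRel n k) w w') :
    blen (bmk n k w) ≤ L + 1 → ∀ x U y V, w = FreeMonoid.of x * U → w' = FreeMonoid.of y * V →
      HeadRel x (bmk n k U) y (bmk n k V) := by
  induction h with
  | of a b hab => exact fun _ x U y V h1 h2 => headRel_of_bRel hab h1 h2
  | refl a =>
    rintro - x U y V h1 h2
    obtain ⟨rfl, rfl⟩ := FreeMonoid.of_mul_inj (h1.symm.trans h2)
    exact Or.inl ⟨rfl, rfl⟩
  | symm hab ih =>
    intro hl x U y V h1 h2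
    exact (ih (by rwa [blen_bmk_eq hab]) y V x U h2 h1).symm
  | @trans a b c hab hbc ih1 ih2 =>
    intro hl x U z W h1 h2
    have hb := blen_bmk_eq hab
    cases b using FreeMonoid.casesOn with
    | one => simp [h1, bmk_of] at hb
    | of_mul y V =>
      have hy : bmk n k (FreeMonoid.of y * V) = bgen n k y * bmk n k V := map_mul _ _ _
      refine H.trans hk ?_ (ih1 hl x U y V h1 rfl) (ih2 (hb ▸ hl) y V z W rfl h2)
      rw [hb, hy] at hl
      simp at hl
      omega
  | @mul a b c d hab hcd ih1 ih2 =>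
    intro hl x U y V h1 h2
    have hb := blen_bmk_eq hab
    cases a using FreeMonoid.casesOn with
    | one =>
      cases b using FreeMonoid.casesOn with
      | one => exact ih2 (by simpa using hl) x U y V (by simpa using h1) (by simpa using h2)
      | of_mul z B =>
        simp [bmk_of] at hb
        omega
    | of_mul z A =>
      cases b using FreeMonoid.casesOn with
      | one => simp [bmk_of] at hb
      | of_mul z' B =>
        rw [mul_assoc] at h1 h2
        obtain ⟨rfl, rfl⟩ := FreeMonoid.of_mul_inj h1
        obtain ⟨rfl, rfl⟩ := FreeMonoid.of_mul_inj h2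
        have hcd' : bmk n k c = bmk n k d := (Con.eq _).2 hcd
        rw [map_mul, map_mul, hcd']
        refine (ih1 ?_ _ _ _ _ rfl rfl).mul_right _
        rw [map_mul, blen_mul] at hl
        omega

theorem reducesBelow (hk : k ≠ 0) (L : ℕ) : ReducesBelow n k L := by
  induction L with
  | zero => exact fun x u y v h => absurd h (Nat.not_lt_zero _)
  | succ L ih =>
    intro x u y v hu h
    induction u using Con.induction_on with
    | H U =>
      induction v using Con.induction_on with
      | H V =>
        refine ih.headRel hk ((Con.eq _).1 h : ConGen.Rel _ (FreeMonoid.of x * U)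
          (FreeMonoid.of y * V)) ?_ x U y V rfl rfl
        rw [map_mul, blen_mul]
        change blen (bgen n k x) + blen (bmk n k U) ≤ L + 1
        have : blen (bmk n k U) < L + 1 := hu
        simp
        omega

theorem bgen_mul_left_cancel (hk : k ≠ 0) {x : Gen n} {p q : BMon n k}
    (h : bgen n k x * p = bgen n k x * q) : p = q :=
  (reducesBelow hk (blen p + 1)).cancel h (Nat.lt_succ_self _)

theorem bmon_mul_left_cancel (hk : k ≠ 0) (a : BMon n k) {p q : BMon n k} (h : a * p = a * q) :
    p = q := by
  induction hl : blen a generalizing a with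
  | zero => simpa [eq_one_of_blen_eq_zero hl] using h
  | succ l ih =>
    rcases BMon.eq_one_or_eq_bgen_mul a with rfl | ⟨x, b, rfl⟩
    · simp at hl
    · simp only [blen_mul, blen_bgen] at hl
      rw [mul_assoc, mul_assoc] at h
      exact ih b (bgen_mul_left_cancel hk h) (by omega)

theorem bmon_dvd_of_mul_dvd_mul_left (hk : k ≠ 0) (a : BMon n k) {p q : BMon n k}
    (h : a * p ∣ a * q) : p ∣ q := by
  obtain ⟨c, hc⟩ := h
  exact ⟨c, bmon_mul_left_cancel hk a (by rw [hc, mul_assoc])⟩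

/-- `m` is a least common right multiple of `a` and `b`. -/
def IsLeastRightMultiple {M : Type*} [Monoid M] (a b m : M) : Prop :=
  a ∣ m ∧ b ∣ m ∧ ∀ z, a ∣ z → b ∣ z → m ∣ z

theorem exists_bgen_lcm (hk : k ≠ 0) (x y : Gen n) :
    ∃ c d, bgen n k x * c = bgen n k y * d ∧
      ∀ z, bgen n k x ∣ z → bgen n k y ∣ z → bgen n k x * c ∣ z := by
  by_cases hxy : x = y
  · subst hxy
    exact ⟨1, 1, rfl, fun z h _ => by simpa using h⟩
  by_cases hfar : GenFar x y
  · refine ⟨_, _, bgen_far hfar, ?_⟩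
    rintro _ ⟨u, rfl⟩ ⟨v, h⟩
    obtain ⟨r, rfl, -⟩ := (reducesBelow hk _).far hfar h (Nat.lt_succ_self _)
    exact mul_dvd_mul_left _ (dvd_mul_right _ _)
  by_cases hadj : GenAdj x y
  · refine ⟨bgen n k y * bgen n k x, bgen n k x * bgen n k y, by
      simpa only [mul_assoc] using bgen_adj hadj, ?_⟩
    rintro _ ⟨u, rfl⟩ ⟨v, h⟩
    obtain ⟨r, rfl, -⟩ := (reducesBelow hk _).adj hadj h (Nat.lt_succ_self _)
    rw [← mul_assoc (bgen n k y)]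
    exact mul_dvd_mul_left _ (dvd_mul_right _ _)
  · have htwin : GenTwin x y := ⟨hxy, by omega⟩
    refine ⟨_, _, bgen_genNext htwin, ?_⟩
    rintro _ ⟨u, rfl⟩ ⟨v, h⟩
    obtain ⟨r, rfl, -⟩ := (reducesBelow hk _).twin htwin h (Nat.lt_succ_self _)
    exact mul_dvd_mul_left _ (dvd_mul_right _ _)

theorem exists_lcm_of_dvd (hk : k ≠ 0) {a b z : BMon n k} (ha : a ∣ z) (hb : b ∣ z) :
    ∃ m, IsLeastRightMultiple a b m := by
  induction hl : blen z using Nat.strong_induction_on generalizing a b z with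
  | _ l ih =>
    subst hl
    rcases BMon.eq_one_or_eq_bgen_mul a with rfl | ⟨x, a, rfl⟩
    · exact ⟨b, one_dvd _, dvd_rfl, fun _ _ h => h⟩
    rcases BMon.eq_one_or_eq_bgen_mul b with rfl | ⟨y, b, rfl⟩
    · exact ⟨bgen n k x * a, dvd_rfl, one_dvd _, fun _ h _ => h⟩
    obtain ⟨c, d, hcd, hmin⟩ := exists_bgen_lcm (k := k) hk x y
    have hcz := hmin z (dvd_of_mul_right_dvd ha) (dvd_of_mul_right_dvd hb)
    have key : ∀ (x : Gen n) (a c : BMon n k), bgen n k x * a ∣ z → bgen n k x * c ∣ z →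
        ∃ e, a ∣ c * e ∧ bgen n k x * c * e ∣ z ∧
          ∀ w, bgen n k x * a ∣ bgen n k x * c * w → e ∣ w := by
      rintro x a c ⟨u, rfl⟩ hc
      rw [mul_assoc] at hc
      obtain ⟨m, h1, ⟨e, rfl⟩, h3⟩ := ih _ (by simp) (dvd_mul_right a u)
        (bmon_dvd_of_mul_dvd_mul_left hk _ hc) rfl
      refine ⟨e, h1, ?_, fun w hw => ?_⟩
      · rw [mul_assoc, mul_assoc]
        exact mul_dvd_mul_left _
          (h3 _ (dvd_mul_right a u) (bmon_dvd_of_mul_dvd_mul_left hk _ hc))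
      · rw [mul_assoc] at hw
        exact bmon_dvd_of_mul_dvd_mul_left hk c
          (h3 _ (bmon_dvd_of_mul_dvd_mul_left hk _ hw) (dvd_mul_right _ _))
    obtain ⟨e, he1, he2, he3⟩ := key x a c ha hcz
    obtain ⟨f, hf1, hf2, hf3⟩ := key y b d hb (hcd ▸ hcz)
    rw [← hcd] at hf2 hf3
    obtain ⟨z', rfl⟩ := hcz
    obtain ⟨g, hg1, hg2, hg3⟩ := ih _ (by simp)
      (bmon_dvd_of_mul_dvd_mul_left hk _ he2) (bmon_dvd_of_mul_dvd_mul_left hk _ hf2) rfl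
    refine ⟨bgen n k x * c * g, ?_, ?_, fun w hwa hwb => ?_⟩
    · rw [mul_assoc]
      exact mul_dvd_mul_left _ (he1.trans (mul_dvd_mul_left _ hg1))
    · rw [hcd, mul_assoc]
      exact mul_dvd_mul_left _ (hf1.trans (mul_dvd_mul_left _ hg2))
    · obtain ⟨w, rfl⟩ := hmin w (dvd_of_mul_right_dvd hwa) (dvd_of_mul_right_dvd hwb)
      exact mul_dvd_mul_left _ (hg3 _ (he3 _ hwa) (hf3 _ hwb))

section Garside

/-- The generator `s̃_j`, or `1` if `j` is out of range. -/
def sgen (n : ℕ) (k : ℤ) (j : ℕ) : BMon n k :=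
  if h : 3 ≤ j ∧ j ≤ n then bgen n k (Sum.inr ⟨j, h⟩) else 1

/-- The generator `t̃_i`. -/
def tgen (n : ℕ) (k : ℤ) (i : ℤ) : BMon n k := bgen n k (Sum.inl i)

theorem sgen_comm {i j : ℕ} (h : i + 1 < j) : Commute (sgen n k i) (sgen n k j) := by
  unfold sgen
  split_ifs
  · exact bgen_far (Or.inl h)
  all_goals simp

theorem tgen_sgen_comm {i : ℤ} {j : ℕ} (h : 4 ≤ j) : Commute (tgen n k i) (sgen n k j) := by
  unfold sgen
  split_ifs
  · exact bgen_far (Or.inl (by simp only [genPos]; omega))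
  · simp

theorem sgen_braid {j : ℕ} (h : 3 ≤ j) (hn : j + 1 ≤ n) :
    sgen n k j * sgen n k (j + 1) * sgen n k j =
      sgen n k (j + 1) * sgen n k j * sgen n k (j + 1) := by
  rw [sgen, sgen, dif_pos ⟨h, by omega⟩, dif_pos ⟨by omega, hn⟩]
  exact bgen_adj (Or.inl rfl)

theorem sgen_tgen_braid (hn : 3 ≤ n) (i : ℤ) :
    sgen n k 3 * tgen n k i * sgen n k 3 = tgen n k i * sgen n k 3 * tgen n k i := by
  rw [sgen, dif_pos ⟨le_rfl, hn⟩]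
  exact bgen_adj (Or.inr rfl)

theorem tgen_mul_tgen (i j : ℤ) :
    tgen n k i * tgen n k (i - k) = tgen n k j * tgen n k (j - k) := by
  simp only [tgen, bgen, ← map_mul]
  exact bmk_eq_of_rel (BRel.tt i j)

/-- The conjugates `s̃_{j+2} ⋯ s̃_3 Δ s̃_3 ⋯ s̃_{j+2}` of `Δ = t̃_0 t̃_{-k}`. -/
def garsideFactor (n : ℕ) (k : ℤ) : ℕ → BMon n k
  | 0 => tgen n k 0 * tgen n k (0 - k)
  | j + 1 => sgen n k (j + 3) * garsideFactor n k j * sgen n k (j + 3)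

/-- The product of the first `j + 1` factors `garsideFactor`; a Garside element for `j + 2 = n`. -/
def garsideElt (n : ℕ) (k : ℤ) : ℕ → BMon n k
  | 0 => garsideFactor n k 0
  | j + 1 => garsideElt n k j * garsideFactor n k (j + 1)

theorem tgen_mul_garsideFactor_zero (i : ℤ) :
    tgen n k i * garsideFactor n k 0 = garsideFactor n k 0 * tgen n k (i - k - k) := by
  rw [garsideFactor, tgen_mul_tgen 0 (i - k), ← mul_assoc, tgen_mul_tgen (i - k) i]

theorem tgen_mul_garsideFactor_succ {j : ℕ} (hn : j + 3 ≤ n) (i : ℤ) :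
    tgen n k i * garsideFactor n k (j + 1) = garsideFactor n k (j + 1) * tgen n k (i - k) := by
  induction j with
  | zero =>
    have h1 := sgen_tgen_braid (k := k) hn i
    have h2 := sgen_tgen_braid (k := k) hn (i - k)
    simp only [garsideFactor, zero_add, tgen_mul_tgen 0 i]
    calc tgen n k i * (sgen n k 3 * (tgen n k i * tgen n k (i - k)) * sgen n k 3)
        = (tgen n k i * sgen n k 3 * tgen n k i) * tgen n k (i - k) * sgen n k 3 := by
          simp only [mul_assoc]
      _ = sgen n k 3 * tgen n k i * (sgen n k 3 * tgen n k (i - k) * sgen n k 3) := by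
          rw [← h1]; simp only [mul_assoc]
      _ = _ := by rw [h2]; simp only [mul_assoc]
  | succ j ih =>
    have h (i : ℤ) := (tgen_sgen_comm (n := n) (k := k) (i := i) (j := j + 1 + 3) (by omega)).eq
    rw [garsideFactor, ← mul_assoc, ← mul_assoc, h, mul_assoc (sgen n k _), ih (by omega)]
    simp only [mul_assoc, h]

theorem sgen_garsideFactor_comm_of_lt {i j : ℕ} (h : j + 3 < i) :
    Commute (sgen n k i) (garsideFactor n k j) := by
  induction j with
  | zero =>
    exact ((tgen_sgen_comm (by omega)).mul_left (tgen_sgen_comm (by omega))).symm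
  | succ j ih =>
    have := (sgen_comm (n := n) (k := k) (i := j + 3) (j := i) (by omega)).symm
    exact (this.mul_right (ih (by omega))).mul_right this

theorem sgen_garsideFactor_comm_of_gt {i j : ℕ} (hi : 3 ≤ i) (h : i < j + 2) (hn : j + 2 ≤ n) :
    Commute (sgen n k i) (garsideFactor n k j) := by
  induction j with
  | zero => omega
  | succ j ih =>
    by_cases hij : i = j + 2
    · obtain ⟨j, rfl⟩ : ∃ l, j = l + 1 := ⟨j - 1, by omega⟩
      subst hij
      have hb := sgen_braid (n := n) (k := k) (j := j + 3) (by omega) (by omega)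
      have hc := (sgen_garsideFactor_comm_of_lt (n := n) (k := k) (i := j + 4) (j := j)
        (by omega)).eq
      change sgen n k (j + 3) * (sgen n k (j + 4) *
        (sgen n k (j + 3) * garsideFactor n k j * sgen n k (j + 3)) * sgen n k (j + 4)) =
        (sgen n k (j + 4) * (sgen n k (j + 3) * garsideFactor n k j * sgen n k (j + 3)) *
          sgen n k (j + 4)) * sgen n k (j + 3)
      calc _ = (sgen n k (j + 3) * sgen n k (j + 4) * sgen n k (j + 3)) * garsideFactor n k j *
              sgen n k (j + 3) * sgen n k (j + 4) := by simp only [mul_assoc]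
        _ = sgen n k (j + 4) * sgen n k (j + 3) * (sgen n k (j + 4) * garsideFactor n k j) *
              sgen n k (j + 3) * sgen n k (j + 4) := by rw [hb]; simp only [mul_assoc]
        _ = sgen n k (j + 4) * sgen n k (j + 3) * garsideFactor n k j *
              (sgen n k (j + 4) * sgen n k (j + 3) * sgen n k (j + 4)) := by
          rw [hc]; simp only [mul_assoc]
        _ = _ := by rw [← hb]; simp only [mul_assoc]
    · have := sgen_comm (n := n) (k := k) (i := i) (j := j + 3) (by omega)
      exact (this.mul_right (ih (by omega) (by omega))).mul_right this

theorem garsideFactor_comm {i j : ℕ} (h : i < j) (hn : j + 2 ≤ n) :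
    Commute (garsideFactor n k i) (garsideFactor n k j) := by
  induction i with
  | zero =>
    obtain ⟨j, rfl⟩ : ∃ l, j = l + 1 := ⟨j - 1, by omega⟩
    have h1 := tgen_mul_garsideFactor_succ (k := k) (j := j) hn
    change tgen n k 0 * tgen n k (0 - k) * garsideFactor n k (j + 1) =
      garsideFactor n k (j + 1) * (tgen n k 0 * tgen n k (0 - k))
    rw [mul_assoc, h1, ← mul_assoc, h1, mul_assoc, tgen_mul_tgen]
  | succ i ih =>
    have := sgen_garsideFactor_comm_of_gt (k := k) (i := i + 3) (j := j) (by omega) (by omega) hn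
    exact (this.mul_left (ih (by omega))).mul_left this

theorem garsideElt_garsideFactor_comm {i j : ℕ} (h : i < j) (hn : j + 2 ≤ n) :
    Commute (garsideElt n k i) (garsideFactor n k j) := by
  induction i with
  | zero => exact garsideFactor_comm h hn
  | succ i ih => exact (ih (by omega)).mul_left (garsideFactor_comm h hn)

theorem sgen_garsideElt_comm_of_lt {i j : ℕ} (h : j + 3 < i) :
    Commute (sgen n k i) (garsideElt n k j) := by
  induction j with
  | zero => exact sgen_garsideFactor_comm_of_lt h
  | succ j ih => exact (ih (by omega)).mul_right (sgen_garsideFactor_comm_of_lt h)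

theorem sgen_garsideFactor_mul_comm {j : ℕ} (hn : j + 3 ≤ n) :
    Commute (sgen n k (j + 3)) (garsideFactor n k j * garsideFactor n k (j + 1)) := by
  have h := (garsideFactor_comm (k := k) (Nat.lt_succ_self j) hn).eq
  change _ = _
  nth_rw 2 [h]
  simp only [garsideFactor, mul_assoc]

theorem sgen_garsideElt_comm {i j : ℕ} (hi : 3 ≤ i) (h : i ≤ j + 2) (hn : j + 2 ≤ n) :
    Commute (sgen n k i) (garsideElt n k j) := by
  induction j with
  | zero => omega
  | succ j ih =>
    by_cases hij : i = j + 3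
    · subst hij
      cases j with
      | zero => exact sgen_garsideFactor_mul_comm hn
      | succ j =>
        rw [garsideElt, garsideElt, mul_assoc]
        exact (sgen_garsideElt_comm_of_lt (by omega)).mul_right (sgen_garsideFactor_mul_comm hn)
    · exact (ih (by omega) (by omega)).mul_right
        (sgen_garsideFactor_comm_of_gt hi (by omega) hn)

theorem exists_tgen_mul_garsideElt {j : ℕ} (hn : j + 2 ≤ n) (i : ℤ) :
    ∃ l, tgen n k i * garsideElt n k j = garsideElt n k j * tgen n k l := by
  induction j with
  | zero => exact ⟨_, tgen_mul_garsideFactor_zero i⟩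
  | succ j ih =>
    obtain ⟨l, hl⟩ := ih (by omega)
    exact ⟨l - k, by rw [garsideElt, ← mul_assoc, hl, mul_assoc,
      tgen_mul_garsideFactor_succ hn, mul_assoc]⟩

theorem tgen_dvd_garsideElt (i : ℤ) (j : ℕ) : tgen n k i ∣ garsideElt n k j := by
  induction j with
  | zero => exact ⟨_, tgen_mul_tgen 0 i⟩
  | succ j ih => exact dvd_mul_of_dvd_left ih _

theorem sgen_dvd_garsideElt {i j : ℕ} (hi : 3 ≤ i) (h : i ≤ j + 2) (hn : j + 2 ≤ n) :
    sgen n k i ∣ garsideElt n k j := by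
  induction j with
  | zero => omega
  | succ j ih =>
    by_cases hij : i = j + 3
    · subst hij
      rw [garsideElt, (garsideElt_garsideFactor_comm (Nat.lt_succ_self j) hn).eq, garsideFactor,
        mul_assoc, mul_assoc]
      exact dvd_mul_right _ _
    · exact dvd_mul_of_dvd_left (ih (by omega) (by omega)) _

theorem exists_garside (hn : 2 ≤ n) :
    ∃ g : BMon n k, (∀ x, bgen n k x ∣ g) ∧ ∀ x, ∃ y, bgen n k x * g = g * bgen n k y := by
  obtain ⟨j, rfl⟩ : ∃ j, n = j + 2 := ⟨n - 2, by omega⟩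
  have hs (i : SIdx (j + 2)) : bgen (j + 2) k (Sum.inr i) = sgen (j + 2) k i.val := by
    rw [sgen, dif_pos i.2]
  refine ⟨garsideElt (j + 2) k j, ?_, ?_⟩
  · rintro (i | i)
    · exact tgen_dvd_garsideElt i j
    · exact hs i ▸ sgen_dvd_garsideElt i.2.1 i.2.2 le_rfl
  · rintro (i | i)
    · obtain ⟨l, hl⟩ := exists_tgen_mul_garsideElt (k := k) (le_refl (j + 2)) i
      exact ⟨Sum.inl l, hl⟩
    · exact ⟨Sum.inr i, hs i ▸ (sgen_garsideElt_comm i.2.1 i.2.2 le_rfl).eq⟩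

end Garside

theorem exists_common_right_multiple (hn : 2 ≤ n) (a b : BMon n k) : ∃ z, a ∣ z ∧ b ∣ z := by
  obtain ⟨g, hg, hcomm⟩ := exists_garside (k := k) hn
  have hmul (c : BMon n k) : ∃ d, c * g = g * d := by
    induction hl : blen c generalizing c with
    | zero => exact ⟨1, by simp [eq_one_of_blen_eq_zero hl]⟩
    | succ l ih =>
      rcases BMon.eq_one_or_eq_bgen_mul c with rfl | ⟨x, c, rfl⟩
      · exact ⟨1, by simp⟩
      · simp only [blen_mul, blen_bgen] at hl
        obtain ⟨d, hd⟩ := ih c (by omega)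
        obtain ⟨y, hy⟩ := hcomm x
        exact ⟨bgen n k y * d, by rw [mul_assoc, hd, ← mul_assoc, hy, mul_assoc]⟩
  have hpow (m : ℕ) (c : BMon n k) : g ^ m ∣ c * g ^ m := by
    induction m generalizing c with
    | zero => simp
    | succ m ih =>
      obtain ⟨d, hd⟩ := hmul c
      rw [pow_succ', ← mul_assoc, hd, mul_assoc]
      exact mul_dvd_mul_left _ (ih d)
  have hdvd (c : BMon n k) : ∃ m, c ∣ g ^ m := by
    induction hl : blen c generalizing c with
    | zero => exact ⟨0, by simp [eq_one_of_blen_eq_zero hl]⟩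
    | succ l ih =>
      rcases BMon.eq_one_or_eq_bgen_mul c with rfl | ⟨x, c, rfl⟩
      · exact ⟨0, one_dvd _⟩
      · simp only [blen_mul, blen_bgen] at hl
        obtain ⟨m, hm⟩ := ih c (by omega)
        obtain ⟨y, hy⟩ := hg x
        refine ⟨m + 1, ?_⟩
        rw [pow_succ']
        nth_rw 1 [hy]
        rw [mul_assoc]
        exact mul_dvd_mul_left _ (hm.trans (hpow m y))
  obtain ⟨p, hp⟩ := hdvd a
  obtain ⟨q, hq⟩ := hdvd b
  exact ⟨g ^ (p + q), hp.trans (pow_dvd_pow g (Nat.le_add_right _ _)),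
    hq.trans (pow_dvd_pow g (Nat.le_add_left _ _))⟩

theorem exists_right_lcm (hn : 2 ≤ n) (hk : k ≠ 0) (a b : BMon n k) :
    ∃ m, IsLeastRightMultiple a b m := by
  obtain ⟨z, ha, hb⟩ := exists_common_right_multiple hn a b
  exact exists_lcm_of_dvd hk ha hb

theorem exists_left_gcd (hn : 2 ≤ n) (hk : k ≠ 0) (a b : BMon n k) :
    ∃ g, g ∣ a ∧ g ∣ b ∧ ∀ z, z ∣ a → z ∣ b → z ∣ g := by
  have hle {z : BMon n k} (h : z ∣ a) : blen z ≤ blen a := by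
    obtain ⟨c, rfl⟩ := h
    simp
  obtain ⟨_, ⟨g, ⟨hga, hgb⟩, rfl⟩, hmax⟩ :=
    (show BddAbove (blen '' {g | g ∣ a ∧ g ∣ b}) by
      refine ⟨blen a, ?_⟩
      rintro _ ⟨g, hg, rfl⟩
      exact hle hg.1).exists_isGreatest_of_nonempty ⟨_, 1, ⟨one_dvd _, one_dvd _⟩, rfl⟩
  refine ⟨g, hga, hgb, fun z hza hzb => ?_⟩
  obtain ⟨m, ⟨c, rfl⟩, hz, hm⟩ := exists_right_lcm hn hk g z
  have hlen := hmax ⟨_, ⟨hm a hga hza, hm b hgb hzb⟩, rfl⟩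
  rw [blen_mul] at hlen
  rwa [eq_one_of_blen_eq_zero (a := c) (by omega), mul_one] at hz

/-- Word reversal, as a homomorphism to the opposite monoid with parameter `-k`. -/
def revHom (n : ℕ) {k l : ℤ} (h : k + l = 0) : BMon n k →* (BMon n l)ᵐᵒᵖ :=
  Con.lift (conGen (BRel n k)) (FreeMonoid.lift fun x => MulOpposite.op (bgen n l x)) <| by
    rw [Con.conGen_le]
    intro a b hab
    rw [Con.ker_rel]
    apply MulOpposite.unop_injective
    cases hab with
    | braid i j h =>
      have := bgen_adj (n := n) (k := l) (x := Sum.inr i) (y := Sum.inr j) h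
      simpa [sw, mul_assoc] using this
    | comm i j h =>
      have := bgen_far (n := n) (k := l) (x := Sum.inr i) (y := Sum.inr j) h
      simpa [sw] using this.symm
    | ts3 i j h =>
      have := bgen_adj (n := n) (k := l) (x := Sum.inr j) (y := Sum.inl i)
        (Or.inr (by simp [genPos, h]))
      simpa [sw, tw, mul_assoc] using this
    | tsj i j h =>
      have := bgen_far (n := n) (k := l) (x := Sum.inl i) (y := Sum.inr j)
        (Or.inl (by simp only [genPos]; omega))
      simpa [sw, tw] using this
    | tt i j =>
      obtain rfl : l = -k := by omega
      simpa [tw, tgen] using tgen_mul_tgen (n := n) (k := -k) (i - k) (j - k)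

/-- Word reversal. -/
def rev (n : ℕ) {k l : ℤ} (h : k + l = 0) (a : BMon n k) : BMon n l := (revHom n h a).unop

theorem rev_mul {l : ℤ} (h : k + l = 0) (a b : BMon n k) :
    rev n h (a * b) = rev n h b * rev n h a := by
  simp [rev]

theorem rev_bgen {l : ℤ} (h : k + l = 0) (x : Gen n) : rev n h (bgen n k x) = bgen n l x := by
  change (FreeMonoid.lift (fun x => MulOpposite.op (bgen n l x)) (FreeMonoid.of x)).unop = _
  simp

theorem rev_rev {l : ℤ} (h : k + l = 0) (h' : l + k = 0) (a : BMon n k) :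
    rev n h' (rev n h a) = a := by
  induction hl : blen a generalizing a with
  | zero => simp [eq_one_of_blen_eq_zero hl, rev]
  | succ m ih =>
    rcases BMon.eq_one_or_eq_bgen_mul a with rfl | ⟨x, a, rfl⟩
    · simp at hl
    · simp only [blen_mul, blen_bgen] at hl
      rw [rev_mul, rev_mul, rev_bgen, rev_bgen, ih a (by omega)]

theorem rev_dvd_iff {l : ℤ} (h : k + l = 0) (h' : l + k = 0) (a : BMon n l) (b : BMon n k) :
    a ∣ rev n h b ↔ ∃ w, b = w * rev n h' a := by
  constructor
  · rintro ⟨c, hc⟩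
    exact ⟨rev n h' c, by rw [← rev_mul, ← hc, rev_rev]⟩
  · rintro ⟨w, rfl⟩
    rw [rev_mul, rev_rev]
    exact dvd_mul_right _ _

end Words

/-- any two elements of `B^{⊕k}(∞,∞,n)` have a least common right multiple
and a greatest common left divisor for left divisibility, and a least common left multiple
and a greatest common right divisor for right divisibility. -/
theorem stmt_10 (n : ℕ) (hn : 2 ≤ n) (k : ℤ) (hk : k ≠ 0) (a b : BMon n k) :
    (∃ m : BMon n k, (∃ w, m = a * w) ∧ (∃ w, m = b * w) ∧
      ∀ z : BMon n k, (∃ w, z = a * w) → (∃ w, z = b * w) → ∃ w, z = m * w) ∧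
    (∃ g : BMon n k, (∃ w, a = g * w) ∧ (∃ w, b = g * w) ∧
      ∀ z : BMon n k, (∃ w, a = z * w) → (∃ w, b = z * w) → ∃ w, g = z * w) ∧
    (∃ m : BMon n k, (∃ w, m = w * a) ∧ (∃ w, m = w * b) ∧
      ∀ z : BMon n k, (∃ w, z = w * a) → (∃ w, z = w * b) → ∃ w, z = w * m) ∧
    (∃ g : BMon n k, (∃ w, a = w * g) ∧ (∃ w, b = w * g) ∧
      ∀ z : BMon n k, (∃ w, a = w * z) → (∃ w, b = w * z) → ∃ w, g = w * z) := by
  have h : k + -k = 0 := by omega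
  have h' : -k + k = 0 := by omega
  have hdvd (c d : BMon n k) : rev n h c ∣ rev n h d ↔ ∃ w, d = w * c := by
    rw [rev_dvd_iff h h', rev_rev]
  refine ⟨exists_right_lcm hn hk a b, exists_left_gcd hn hk a b, ?_, ?_⟩
  · obtain ⟨m, h1, h2, h3⟩ := exists_right_lcm hn (neg_ne_zero.2 hk) (rev n h a) (rev n h b)
    obtain ⟨m, rfl⟩ : ∃ m', m = rev n h m' := ⟨rev n h' m, (rev_rev h' h m).symm⟩
    exact ⟨m, (hdvd _ _).1 h1, (hdvd _ _).1 h2, fun z ha hb =>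
      (hdvd _ _).1 (h3 _ ((hdvd _ _).2 ha) ((hdvd _ _).2 hb))⟩
  · obtain ⟨g, h1, h2, h3⟩ := exists_left_gcd hn (neg_ne_zero.2 hk) (rev n h a) (rev n h b)
    obtain ⟨g, rfl⟩ : ∃ g', g = rev n h g' := ⟨rev n h' g, (rev_rev h' h g).symm⟩
    exact ⟨g, (hdvd _ _).1 h1, (hdvd _ _).1 h2, fun z ha hb =>
      (hdvd _ _).1 (h3 _ ((hdvd _ _).2 ha) ((hdvd _ _).2 hb))⟩
end
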